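/- arXiv:2304.08722 — 3 statements merged into one kernel-verified Lean document; each statement's English description precedes it below -/
import Mathlib

section
/- Let α = ({1}^{a_1}, b_1+2, {1}^{a_2}, b_2+2, …, {1}^{a_n}, b_n+2) be an admissible index with dual index β = ({1}^{b_n}, a_n+2, {1}^{b_{n-1}}, a_{n-1}+2, …, {1}^{b_1}, a_1+2), where (a_1,b_1),…,(a_n,b_n) are pairs of nonnegative integers. Then for every nonnegative integer n one has Z_U(α; {2}^n) = Z_L(β; {2}^n). -/
open scoped BigOperators

/-- Multiple zeta value `ζ(α₁,…,α_r) = Σ_{1 ≤ k₁ < ⋯ < k_r} k₁^{-α₁} ⋯ k_r^{-α_r}`;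
`mzv [] = 1`. -/
noncomputable def mzv (α : List ℕ) : ℝ :=
  ∑' f : {f : Fin α.length → ℕ+ // StrictMono f},
    ∏ i : Fin α.length, ((f.1 i : ℝ) ^ (α.get i))⁻¹

/-- Multiple zeta-star value `ζ⋆(α₁,…,α_r) = Σ_{1 ≤ k₁ ≤ ⋯ ≤ k_r} k₁^{-α₁} ⋯ k_r^{-α_r}`;
`mzvStar [] = 1`. -/
noncomputable def mzvStar (α : List ℕ) : ℝ :=
  ∑' f : {f : Fin α.length → ℕ+ // Monotone f},
    ∏ i : Fin α.length, ((f.1 i : ℝ) ^ (α.get i))⁻¹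

/-- `Z_U(α;β) = Σ_{1≤k₁<⋯<k_r} k₁^{-α₁}⋯k_r^{-α_r} Σ_{1≤ℓ₁≤⋯≤ℓ_m≤k_r} ℓ₁^{-β₁}⋯ℓ_m^{-β_m}`. -/
noncomputable def ZU (α β : List ℕ) : ℝ :=
  ∑' p : {p : (Fin α.length → ℕ+) × (Fin β.length → ℕ+) //
      StrictMono p.1 ∧ Monotone p.2 ∧
      ∀ j : Fin β.length, (j : ℕ) = β.length - 1 →
        ∀ i : Fin α.length, (i : ℕ) = α.length - 1 → p.2 j ≤ p.1 i},
    (∏ i : Fin α.length, ((p.1.1 i : ℝ) ^ (α.get i))⁻¹) *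
      ∏ j : Fin β.length, ((p.1.2 j : ℝ) ^ (β.get j))⁻¹

/-- `Z_L(α;β) = Σ_{1≤k₁<⋯<k_r} k₁^{-α₁}⋯k_r^{-α_r} Σ_{k₁≤ℓ₁≤⋯≤ℓ_m} ℓ₁^{-β₁}⋯ℓ_m^{-β_m}`. -/
noncomputable def ZL (α β : List ℕ) : ℝ :=
  ∑' p : {p : (Fin α.length → ℕ+) × (Fin β.length → ℕ+) //
      StrictMono p.1 ∧ Monotone p.2 ∧
      ∀ i : Fin α.length, (i : ℕ) = 0 →
        ∀ j : Fin β.length, (j : ℕ) = 0 → p.1 i ≤ p.2 j},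
    (∏ i : Fin α.length, ((p.1.1 i : ℝ) ^ (α.get i))⁻¹) *
      ∏ j : Fin β.length, ((p.1.2 j : ℝ) ^ (β.get j))⁻¹

/-- `Z_B(α;β) = Σ_{1≤k₁<⋯<k_r} k₁^{-α₁}⋯k_r^{-α_r} Σ_{k₁≤ℓ₁≤⋯≤ℓ_m≤k_r} ℓ₁^{-β₁}⋯ℓ_m^{-β_m}`. -/
noncomputable def ZB (α β : List ℕ) : ℝ :=
  ∑' p : {p : (Fin α.length → ℕ+) × (Fin β.length → ℕ+) //
      StrictMono p.1 ∧ Monotone p.2 ∧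
      (∀ i : Fin α.length, (i : ℕ) = 0 →
        ∀ j : Fin β.length, (j : ℕ) = 0 → p.1 i ≤ p.2 j) ∧
      ∀ j : Fin β.length, (j : ℕ) = β.length - 1 →
        ∀ i : Fin α.length, (i : ℕ) = α.length - 1 → p.2 j ≤ p.1 i},
    (∏ i : Fin α.length, ((p.1.1 i : ℝ) ^ (α.get i))⁻¹) *
      ∏ j : Fin β.length, ((p.1.2 j : ℝ) ^ (β.get j))⁻¹

/-- The connector `k! m! / (k + m)!`. -/
noncomputable def connector (k m : ℕ) : ℝ :=
  (k.factorial * m.factorial : ℝ) / (k + m).factorial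

lemma connector_nonneg (k m : ℕ) : 0 ≤ connector k m := by
  unfold connector; positivity

lemma connector_comm (k m : ℕ) : connector k m = connector m k := by
  unfold connector; rw [mul_comm, add_comm]

lemma connector_zero_right (k : ℕ) : connector k 0 = 1 := by
  have : (k.factorial : ℝ) ≠ 0 := by positivity
  simp [connector, this]

lemma connector_succ_right (k m : ℕ) :
    connector k (m + 1) = connector k m * ((m + 1) / (k + m + 1)) := by
  unfold connector
  rw [← add_assoc, Nat.factorial_succ, Nat.factorial_succ]
  push_cast
  field_simp

lemma connector_succ_left (k m : ℕ) :
    connector (k + 1) m = connector k m * ((k + 1) / (k + m + 1)) := by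
  rw [connector_comm, connector_succ_right, connector_comm, add_comm (m : ℝ)]

lemma connector_le_one (k m : ℕ) : connector k m ≤ 1 := by
  induction m with
  | zero => simp [connector_zero_right]
  | succ m ih =>
    rw [connector_succ_right]
    refine mul_le_one₀ ih (by positivity) ?_
    rw [div_le_one (by positivity)]
    linarith [(Nat.cast_nonneg k : (0 : ℝ) ≤ k)]

lemma tendsto_connector (a m : ℕ) :
    Filter.Tendsto (fun i => connector (a + i) (m + 1)) Filter.atTop (nhds 0) := by
  have h : Filter.Tendsto (fun i : ℕ => (m + 1 : ℝ) * (1 / ((i : ℝ) + 1)))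
      Filter.atTop (nhds 0) := by
    simpa using (tendsto_one_div_add_atTop_nhds_zero_nat (𝕜 := ℝ)).const_mul (m + 1 : ℝ)
  refine squeeze_zero (fun i => connector_nonneg _ _) (fun i => ?_) h
  rw [connector_succ_right]
  calc connector (a + i) m * ((m + 1) / (((a + i : ℕ) : ℝ) + m + 1))
      ≤ 1 * ((m + 1) / (((a + i : ℕ) : ℝ) + m + 1)) := by
        gcongr
        exact connector_le_one _ _
    _ ≤ (m + 1 : ℝ) * (1 / ((i : ℝ) + 1)) := by
        rw [one_mul, mul_one_div]
        push_cast
        gcongr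
        linarith [(Nat.cast_nonneg a : (0 : ℝ) ≤ a), (Nat.cast_nonneg m : (0 : ℝ) ≤ m)]

lemma hasSum_connector (a m : ℕ) :
    HasSum (fun i : ℕ => ((a + i + 1 : ℕ) : ℝ)⁻¹ * connector (a + i + 1) (m + 1))
      (((m + 1 : ℕ) : ℝ)⁻¹ * connector a (m + 1)) := by
  rw [hasSum_iff_tendsto_nat_of_nonneg
    fun i => mul_nonneg (by positivity) (connector_nonneg _ _)]
  have h (i : ℕ) : ((a + i + 1 : ℕ) : ℝ)⁻¹ * connector (a + i + 1) (m + 1) =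
      ((m + 1 : ℕ) : ℝ)⁻¹ * connector (a + i) (m + 1) -
        ((m + 1 : ℕ) : ℝ)⁻¹ * connector (a + (i + 1)) (m + 1) := by
    rw [← add_assoc a i 1, connector_succ_left]
    push_cast
    field_simp
    ring
  simp_rw [h, Finset.sum_range_sub']
  simpa using ((tendsto_connector a m).const_mul ((m + 1 : ℕ) : ℝ)⁻¹).const_sub
    (((m + 1 : ℕ) : ℝ)⁻¹ * connector a (m + 1))

open scoped ENNReal

/-- `k ^ (-a)` as an extended nonnegative real, with value `0` at `k = 0` when `a ≠ 0`. -/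
noncomputable def invPow (a k : ℕ) : ℝ≥0∞ := ENNReal.ofReal (((k : ℝ) ^ a)⁻¹)

lemma invPow_add (a b k : ℕ) : invPow (a + b) k = invPow a k * invPow b k := by
  rw [invPow, invPow, invPow, ← ENNReal.ofReal_mul (by positivity), pow_add, mul_inv]

lemma invPow_succ_zero (a : ℕ) : invPow (a + 1) 0 = 0 := by simp [invPow]

/-- The connector as an extended nonnegative real. -/
noncomputable def econn (k m : ℕ) : ℝ≥0∞ := ENNReal.ofReal (connector k m)

lemma econn_comm (k m : ℕ) : econn k m = econn m k := by rw [econn, connector_comm, econn]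

lemma econn_zero_right (k : ℕ) : econn k 0 = 1 := by simp [econn, connector_zero_right]

lemma tsum_ite_lt (a : ℕ) (F : ℕ → ℝ≥0∞) :
    ∑' k, (if a < k then F k else 0) = ∑' i, F (a + i + 1) := by
  rw [← Summable.sum_add_tsum_nat_add' (k := a + 1) ENNReal.summable, Finset.sum_eq_zero, zero_add]
  · refine tsum_congr fun i => ?_
    rw [if_pos (by omega), show i + (a + 1) = a + i + 1 by ring]
  · intro i hi
    rw [if_neg]
    simp at hi
    omega

lemma tsum_invPow_mul_econn (a m : ℕ) (hm : m ≠ 0) :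
    ∑' k, (if a < k then invPow 1 k * econn k m else 0) = invPow 1 m * econn a m := by
  obtain ⟨m, rfl⟩ := Nat.exists_eq_succ_of_ne_zero hm
  rw [tsum_ite_lt]
  have h := hasSum_connector a m
  have hn (i : ℕ) : 0 ≤ ((a + i + 1 : ℕ) : ℝ)⁻¹ * connector (a + i + 1) (m + 1) :=
    mul_nonneg (by positivity) (connector_nonneg _ _)
  simp_rw [invPow, econn, pow_one, Nat.succ_eq_add_one]
  rw [← ENNReal.ofReal_mul (by positivity), ← h.tsum_eq,
    ENNReal.ofReal_tsum_of_nonneg hn h.summable]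
  exact tsum_congr fun i => (ENNReal.ofReal_mul (by positivity)).symm

/-- The operator appending the exponent `a` to a nested sum with prescribed last index. -/
noncomputable def appendExp (a : ℕ) (p : ℕ → ℝ≥0∞) (k : ℕ) : ℝ≥0∞ :=
  invPow a k * ∑ j ∈ Finset.range k, p j

/-- The operator increasing the last exponent of a nested sum by one. -/
noncomputable def raiseExp (p : ℕ → ℝ≥0∞) (k : ℕ) : ℝ≥0∞ := invPow 1 k * p k

/-- The connected sum of two sequences. -/
noncomputable def connectedSum (p q : ℕ → ℝ≥0∞) : ℝ≥0∞ :=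
  ∑' k, ∑' m, p k * q m * econn k m

lemma connectedSum_comm (p q : ℕ → ℝ≥0∞) : connectedSum p q = connectedSum q p := by
  rw [connectedSum, ENNReal.tsum_comm]
  simp_rw [connectedSum, mul_comm (p _), econn_comm]

lemma sum_range_eq_tsum_ite (p : ℕ → ℝ≥0∞) (k : ℕ) :
    ∑ j ∈ Finset.range k, p j = ∑' j, if j < k then p j else 0 := by
  rw [tsum_eq_sum (s := Finset.range k)]
  · exact Finset.sum_congr rfl fun j hj => by rw [if_pos (Finset.mem_range.1 hj)]
  · intro j hj
    rw [if_neg (by simpa using hj)]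

lemma connectedSum_appendExp (p q : ℕ → ℝ≥0∞) (hq : q 0 = 0) :
    connectedSum (appendExp 1 p) q = connectedSum p (raiseExp q) := by
  calc connectedSum (appendExp 1 p) q
      = ∑' k, ∑' m, ∑' j, (p j * q m) * (if j < k then invPow 1 k * econn k m else 0) := by
        refine tsum_congr fun k => tsum_congr fun m => ?_
        rw [appendExp, sum_range_eq_tsum_ite, mul_assoc, mul_right_comm, mul_comm,
          ← ENNReal.tsum_mul_right]
        refine tsum_congr fun j => ?_
        split_ifs <;> ring
    _ = ∑' j, ∑' m, ∑' k, (p j * q m) * (if j < k then invPow 1 k * econn k m else 0) := by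
        rw [tsum_congr fun k => ENNReal.tsum_comm, ENNReal.tsum_comm]
        exact tsum_congr fun j => ENNReal.tsum_comm
    _ = connectedSum p (raiseExp q) := by
        refine tsum_congr fun j => tsum_congr fun m => ?_
        rw [ENNReal.tsum_mul_left]
        rcases eq_or_ne m 0 with rfl | hm
        · simp [hq, raiseExp]
        · rw [tsum_invPow_mul_econn j m hm, raiseExp]
          ring

/-- `∑_{1 ≤ ℓ₁ ≤ ⋯ ≤ ℓₙ ≤ N} ∏ ℓᵢ⁻²`. -/
noncomputable def lowerStar : ℕ → ℕ → ℝ≥0∞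
  | 0, _ => 1
  | n + 1, N => ∑ c ∈ Finset.range (N + 1), invPow 2 c * lowerStar n c

/-- `∑_{b ≤ ℓ₁ ≤ ⋯ ≤ ℓₙ} ∏ ℓᵢ⁻²`. -/
noncomputable def upperStar : ℕ → ℕ → ℝ≥0∞
  | 0, _ => 1
  | n + 1, b => ∑' c, if b ≤ c then invPow 2 c * upperStar n c else 0

lemma sum_mul_connector_succ (k c : ℕ) :
    ∑ b ∈ Finset.range (c + 1), ((k + 1 : ℕ) : ℝ) * ((b : ℝ)⁻¹ * connector (k + 1) b) =
      ∑ b ∈ Finset.range (c + 1), (k : ℝ) * ((b : ℝ)⁻¹ * connector k b) +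
        c * ((k + 1 : ℕ) : ℝ)⁻¹ * connector (k + 1) c := by
  induction c with
  | zero => simp
  | succ c ih =>
    rw [Finset.sum_range_succ, ih, Finset.sum_range_succ _ (c + 1)]
    simp only [connector_succ_left, connector_succ_right]
    push_cast
    field_simp
    ring

lemma esum_mul_econn_succ (k c : ℕ) :
    ∑ b ∈ Finset.range (c + 1), ((k + 1 : ℕ) : ℝ≥0∞) * (invPow 1 b * econn (k + 1) b) =
      ∑ b ∈ Finset.range (c + 1), (k : ℝ≥0∞) * (invPow 1 b * econn k b) +
        c * invPow 1 (k + 1) * econn (k + 1) c := by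
  have h := congrArg ENNReal.ofReal (sum_mul_connector_succ k c)
  have hn (k b : ℕ) : 0 ≤ (k : ℝ) * ((b : ℝ)⁻¹ * connector k b) :=
    mul_nonneg (by positivity) (mul_nonneg (by positivity) (connector_nonneg _ _))
  have ht (k b : ℕ) : ENNReal.ofReal ((k : ℝ) * ((b : ℝ)⁻¹ * connector k b)) =
      (k : ℝ≥0∞) * (invPow 1 b * econn k b) := by
    rw [ENNReal.ofReal_mul (by positivity), ENNReal.ofReal_mul (by positivity),
      ENNReal.ofReal_natCast, invPow, econn, pow_one]
  rw [ENNReal.ofReal_add (Finset.sum_nonneg fun b _ => hn k b)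
    (mul_nonneg (by positivity) (connector_nonneg _ _)),
    ENNReal.ofReal_sum_of_nonneg fun b _ => hn _ b,
    ENNReal.ofReal_sum_of_nonneg fun b _ => hn k b,
    ENNReal.ofReal_mul (by positivity), ENNReal.ofReal_mul (by positivity),
    ENNReal.ofReal_natCast] at h
  simp_rw [ht] at h
  simpa [invPow, econn] using h

lemma tsum_mul_upperStar_succ (x : ℕ → ℝ≥0∞) (n : ℕ) :
    ∑' b, x b * upperStar (n + 1) b =
      ∑' c, (∑ b ∈ Finset.range (c + 1), x b) * (invPow 2 c * upperStar n c) := by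
  simp_rw [upperStar, ← ENNReal.tsum_mul_left]
  rw [ENNReal.tsum_comm]
  refine tsum_congr fun c => ?_
  rw [sum_range_eq_tsum_ite, ← ENNReal.tsum_mul_right]
  refine tsum_congr fun b => ?_
  simp only [Nat.lt_succ_iff]
  split_ifs <;> simp

lemma natCast_mul_invPow_one (k : ℕ) (hk : k ≠ 0) : (k : ℝ≥0∞) * invPow 1 k = 1 := by
  rw [invPow, ← ENNReal.ofReal_natCast, ← ENNReal.ofReal_mul (by positivity), pow_one,
    mul_inv_cancel₀ (by exact_mod_cast hk), ENNReal.ofReal_one]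

lemma lowerStar_eq_tsum (n k : ℕ) (h : k ≠ 0 ∨ n ≠ 0) :
    lowerStar n k = ∑' b, (k : ℝ≥0∞) * (invPow 1 b * econn k b) * upperStar n b := by
  induction n generalizing k with
  | zero =>
    have hk : k ≠ 0 := by simpa using h
    have h0 := tsum_invPow_mul_econn 0 k hk
    rw [econn_comm, econn_zero_right, mul_one] at h0
    simp only [lowerStar, upperStar, mul_one]
    rw [ENNReal.tsum_mul_left, ← natCast_mul_invPow_one k hk, ← h0]
    congr 1
    refine tsum_congr fun b => ?_
    rcases Nat.eq_zero_or_pos b with rfl | hb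
    · simp [invPow_succ_zero 0]
    · rw [if_pos hb, econn_comm]
  | succ n ih =>
    clear h
    induction k with
    | zero => simp [lowerStar, invPow_succ_zero 1]
    | succ k ihk =>
      rw [tsum_mul_upperStar_succ] at ihk ⊢
      simp_rw [esum_mul_econn_succ, add_mul]
      rw [ENNReal.tsum_add, ← ihk, lowerStar, Finset.sum_range_succ, ← lowerStar,
        ih _ (Or.inl k.succ_ne_zero), ← ENNReal.tsum_mul_left]
      congr 1
      refine tsum_congr fun c => ?_
      rcases eq_or_ne c 0 with rfl | hc
      · simp [invPow_succ_zero 0, invPow_succ_zero 1]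
      · rw [invPow_add 1 1 c, invPow_add 1 1 (k + 1)]
        have h1 := natCast_mul_invPow_one c hc
        have h2 := natCast_mul_invPow_one (k + 1) k.succ_ne_zero
        calc _ = ((k + 1 : ℕ) * invPow 1 (k + 1)) * (invPow 1 (k + 1) * invPow 1 c *
              econn (k + 1) c * upperStar n c) := by ring
          _ = (c * invPow 1 c) * (invPow 1 (k + 1) * invPow 1 c *
              econn (k + 1) c * upperStar n c) := by rw [h1, h2]
          _ = _ := by ring

lemma tsum_raiseExp_mul_lowerStar (p : ℕ → ℝ≥0∞) (hp : p 0 = 0) (n : ℕ) :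
    ∑' k, raiseExp p k * lowerStar n k =
      connectedSum p (raiseExp (upperStar n)) := by
  refine tsum_congr fun k => ?_
  rcases eq_or_ne k 0 with rfl | hk
  · simp [hp, raiseExp]
  · rw [raiseExp, lowerStar_eq_tsum n k (Or.inl hk), ← ENNReal.tsum_mul_left]
    refine tsum_congr fun b => ?_
    calc _ = (k * invPow 1 k) * (p k * (invPow 1 b * upperStar n b) * econn k b) := by ring
      _ = _ := by rw [natCast_mul_invPow_one k hk, one_mul, raiseExp]

lemma tsum_pnat_eq_tsum (F : ℕ → ℝ≥0∞) (h : F 0 = 0) : ∑' k : ℕ+, F k = ∑' k, F k := by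
  have h1 : ∑' k : ℕ+, F k = ∑' k, Set.indicator {k : ℕ | 0 < k} F k :=
    tsum_subtype {k : ℕ | 0 < k} F
  rw [h1]
  refine tsum_congr fun k => ?_
  rcases Nat.eq_zero_or_pos k with rfl | hk
  · simp [h]
  · simp [Set.indicator, hk]

lemma tsum_fin_succ_pnat {r : ℕ} (F : (Fin (r + 1) → ℕ+) → ℝ≥0∞) :
    ∑' f, F f = ∑' (k : ℕ+) (f : Fin r → ℕ+), F (Fin.cons k f) := by
  rw [← ENNReal.tsum_prod, ← (Fin.consEquiv fun _ => ℕ+).tsum_eq]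
  rfl

/-- The tuple of naturals obtained by putting `k₀` in front of a tuple of positive naturals. -/
def consTuple {r : ℕ} (k₀ : ℕ) (f : Fin r → ℕ+) : Fin (r + 1) → ℕ :=
  Matrix.vecCons k₀ fun i => (f i : ℕ)

lemma consTuple_cons {r : ℕ} (k₀ : ℕ) (k : ℕ+) (f : Fin r → ℕ+) :
    consTuple k₀ (Fin.cons k f : Fin (r + 1) → ℕ+) =
      Matrix.vecCons k₀ (consTuple (k : ℕ) f) := by
  unfold consTuple
  congr 1
  ext i
  refine Fin.cases ?_ (fun i => ?_) i <;> simp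

lemma consTuple_cons_last {r : ℕ} (k₀ : ℕ) (k : ℕ+) (f : Fin r → ℕ+) :
    consTuple k₀ (Fin.cons k f : Fin (r + 1) → ℕ+) (Fin.last (r + 1)) =
      consTuple (k : ℕ) f (Fin.last r) := by
  rw [consTuple_cons, ← Fin.succ_last, Matrix.cons_val_succ]

open Classical in
/-- The nested sum `∑_{k₀ < k₁ < ⋯ < k_r} ∏ kᵢ^(-lᵢ) g(k_r)`, equal to `g k₀` when `r = 0`. -/
noncomputable def nestedSum (l : List ℕ) (k₀ : ℕ) (g : ℕ → ℝ≥0∞) : ℝ≥0∞ :=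
  ∑' f : Fin l.length → ℕ+, if StrictMono (consTuple k₀ f) then
    (∏ i, invPow (l.get i) (f i)) * g (consTuple k₀ f (Fin.last _)) else 0

lemma nestedSum_nil (k₀ : ℕ) (g : ℕ → ℝ≥0∞) : nestedSum [] k₀ g = g k₀ := by
  refine (tsum_eq_single (default : Fin 0 → ℕ+)
    fun f hf => absurd (Subsingleton.elim _ _) hf).trans ?_
  rw [if_pos (Subsingleton.strictMono (α := Fin 1) _)]
  simp [consTuple]

lemma nestedSum_cons (a : ℕ) (l : List ℕ) (k₀ : ℕ) (g : ℕ → ℝ≥0∞) :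
    nestedSum (a :: l) k₀ g =
      ∑' k, if k₀ < k then invPow a k * nestedSum l k g else 0 := by
  classical
  rw [← tsum_pnat_eq_tsum _ (if_neg (Nat.not_lt_zero _)), nestedSum]
  refine (tsum_fin_succ_pnat (r := l.length) _).trans (tsum_congr fun k => ?_)
  rw [nestedSum, ← ENNReal.tsum_mul_left]
  by_cases hk : k₀ < k
  · rw [if_pos hk]
    refine tsum_congr fun f => ?_
    have h : StrictMono (consTuple k₀ (Fin.cons k f : Fin (l.length + 1) → ℕ+)) ↔
        StrictMono (consTuple (k : ℕ) f) := by
      rw [consTuple_cons, strictMono_vecCons]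
      exact and_iff_right hk
    by_cases hf : StrictMono (consTuple (k : ℕ) f)
    · rw [if_pos (h.2 hf), if_pos hf]
      have e := consTuple_cons_last k₀ k f
      have e2 : (∏ i : Fin (l.length + 1), invPow ((a :: l).get i)
          ((Fin.cons k f : Fin (l.length + 1) → ℕ+) i)) =
          invPow a k * ∏ i, invPow (l.get i) (f i) := by
        rw [Fin.prod_univ_succ]
        rfl
      exact (congrArg₂ (· * ·) e2 (congrArg g e)).trans (mul_assoc _ _ _)
    · rw [if_neg (mt h.1 hf), if_neg hf, mul_zero]
  · rw [if_neg hk]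
    refine ENNReal.tsum_eq_zero.2 fun f => if_neg fun h => hk ?_
    have h' := consTuple_cons k₀ k f ▸ h
    exact (strictMono_vecCons.1 h').1

/-- Appending a list of exponents to a nested sum, one after another. -/
noncomputable def appendList (l : List ℕ) (p : ℕ → ℝ≥0∞) : ℕ → ℝ≥0∞ :=
  l.foldl (fun p a => appendExp a p) p

lemma tsum_mul_nestedSum (l : List ℕ) (p g : ℕ → ℝ≥0∞) :
    ∑' k, p k * nestedSum l k g = ∑' k, appendList l p k * g k := by
  induction l generalizing p with
  | nil => simp [nestedSum_nil, appendList]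
  | cons a l ih =>
    rw [appendList, List.foldl_cons, ← appendList, ← ih]
    simp_rw [nestedSum_cons, ← ENNReal.tsum_mul_left]
    rw [ENNReal.tsum_comm]
    refine tsum_congr fun k => ?_
    rw [appendExp, sum_range_eq_tsum_ite, mul_right_comm, ← ENNReal.tsum_mul_left]
    refine tsum_congr fun j => ?_
    split_ifs
    · exact mul_comm _ _
    · simp

open Classical in
lemma lowerStar_eq (n N : ℕ) :
    lowerStar n N = ∑' g : Fin n → ℕ+, if Antitone (consTuple N g) then
      ∏ i, invPow 2 (g i) else 0 := by
  induction n generalizing N with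
  | zero =>
    rw [tsum_eq_single (default : Fin 0 → ℕ+) fun f hf => absurd (Subsingleton.elim _ _) hf,
      if_pos (Subsingleton.antitone (α := Fin 1) _)]
    simp [lowerStar]
  | succ n ih =>
    rw [lowerStar, sum_range_eq_tsum_ite, tsum_fin_succ_pnat,
      ← tsum_pnat_eq_tsum _ (by simp [invPow_succ_zero 1])]
    refine tsum_congr fun k => ?_
    simp_rw [consTuple_cons, antitone_vecCons, Fin.prod_univ_succ, Fin.cons_zero, Fin.cons_succ,
      Nat.lt_succ_iff]
    rw [ih, ← ENNReal.tsum_mul_left]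
    by_cases hk : (k : ℕ) ≤ N
    · rw [if_pos hk]
      refine tsum_congr fun f => ?_
      have hk' : consTuple (k : ℕ) f 0 ≤ N := hk
      by_cases hf : Antitone (consTuple (k : ℕ) f) <;> simp [hf, hk']
    · simp [hk, consTuple]

open Classical in
lemma upperStar_eq (n b : ℕ) :
    upperStar n b = ∑' g : Fin n → ℕ+, if Monotone (consTuple b g) then
      ∏ i, invPow 2 (g i) else 0 := by
  induction n generalizing b with
  | zero =>
    rw [tsum_eq_single (default : Fin 0 → ℕ+) fun f hf => absurd (Subsingleton.elim _ _) hf,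
      if_pos (Subsingleton.monotone (α := Fin 1) _)]
    simp [upperStar]
  | succ n ih =>
    rw [upperStar, tsum_fin_succ_pnat,
      ← tsum_pnat_eq_tsum _ (by simp [invPow_succ_zero 1])]
    refine tsum_congr fun k => ?_
    simp_rw [consTuple_cons, monotone_vecCons, Fin.prod_univ_succ, Fin.cons_zero, Fin.cons_succ]
    rw [ih, ← ENNReal.tsum_mul_left]
    by_cases hk : b ≤ (k : ℕ)
    · rw [if_pos hk]
      refine tsum_congr fun f => ?_
      have hk' : b ≤ consTuple (k : ℕ) f 0 := hk
      by_cases hf : Monotone (consTuple (k : ℕ) f) <;> simp [hf, hk']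
    · simp [hk, consTuple]

lemma strictMono_consTuple_zero {r : ℕ} (f : Fin r → ℕ+) :
    StrictMono (consTuple 0 f) ↔ StrictMono f := by
  cases r with
  | zero =>
    exact iff_of_true (Subsingleton.strictMono (α := Fin 1) _)
      (Subsingleton.strictMono (α := Fin 0) _)
  | succ r =>
    rw [consTuple, strictMono_vecCons]
    exact and_iff_right (f 0).pos

lemma strictMono_cons_iff {r : ℕ} (k : ℕ+) (f : Fin r → ℕ+) :
    StrictMono (Fin.cons k f : Fin (r + 1) → ℕ+) ↔ StrictMono (consTuple (k : ℕ) f) := by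
  rw [← strictMono_consTuple_zero, consTuple_cons, strictMono_vecCons]
  exact and_iff_right k.pos

lemma monotone_consTuple {m : ℕ} (b : ℕ+) (g : Fin m → ℕ+) :
    Monotone (consTuple (b : ℕ) g) ↔ Monotone g ∧ ∀ j : Fin m, (j : ℕ) = 0 → b ≤ g j := by
  cases m with
  | zero =>
    exact iff_of_true (Subsingleton.monotone (α := Fin 1) _)
      ⟨Subsingleton.monotone (α := Fin 0) _, fun j => j.elim0⟩
  | succ m =>
    rw [consTuple, monotone_vecCons, and_comm]
    refine and_congr Iff.rfl ⟨fun h j hj => ?_, fun h => h 0 rfl⟩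
    obtain rfl : j = 0 := Fin.ext hj
    exact h

lemma antitone_consTuple {m : ℕ} (b : ℕ+) (g : Fin m → ℕ+) :
    Antitone (consTuple (b : ℕ) g) ↔ Monotone (g ∘ Fin.rev) ∧
      ∀ j : Fin m, (j : ℕ) = m - 1 → (g ∘ Fin.rev) j ≤ b := by
  cases m with
  | zero =>
    exact iff_of_true (Subsingleton.antitone (α := Fin 1) _)
      ⟨Subsingleton.monotone (α := Fin 0) _, fun j => j.elim0⟩
  | succ m =>
    rw [consTuple, antitone_vecCons, and_comm]
    refine and_congr ⟨fun h i j hij => h (Fin.rev_le_rev.2 hij), fun h i j hij => ?_⟩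
      ⟨fun h j hj => ?_, fun h => ?_⟩
    · simpa using h (Fin.rev_le_rev.2 hij)
    · obtain rfl : j = Fin.last m := Fin.ext hj
      simpa using h
    · simpa using h (Fin.last m) rfl

open Classical in
lemma lowerStar_eq_tsum_monotone (m : ℕ) (b : ℕ+) :
    ∑' g : Fin m → ℕ+, (if Monotone g ∧ ∀ j : Fin m, (j : ℕ) = m - 1 → g j ≤ b then
      ∏ i, invPow 2 (g i) else 0) = lowerStar m b := by
  rw [lowerStar_eq, ← (Fin.revPerm.arrowCongr (Equiv.refl ℕ+)).tsum_eq]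
  refine tsum_congr fun g => ?_
  have e : (Fin.revPerm.arrowCongr (Equiv.refl ℕ+)) g = g ∘ Fin.rev := rfl
  have hprod : ∏ i, invPow 2 ((g ∘ Fin.rev) i) = ∏ i, invPow 2 (g i) :=
    Equiv.prod_comp Fin.revPerm fun i => invPow 2 (g i)
  simp_rw [antitone_consTuple, e, hprod]

open Classical in
lemma tsum_subtype_mul_toReal {X Y : Type*} (P : X × Y → Prop) (u : X → ℝ) (v : Y → ℝ)
    (hu : ∀ x, 0 ≤ u x) (hv : ∀ y, 0 ≤ v y) :
    ∑' p : {p // P p}, u p.1.1 * v p.1.2 =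
      (∑' x, ∑' y, if P (x, y) then ENNReal.ofReal (u x) * ENNReal.ofReal (v y) else 0).toReal := by
  rw [← ENNReal.tsum_prod' (f := fun p : X × Y =>
    if P p then ENNReal.ofReal (u p.1) * ENNReal.ofReal (v p.2) else 0)]
  have h := tsum_subtype {p | P p}
    (fun p : X × Y => ENNReal.ofReal (u p.1) * ENNReal.ofReal (v p.2))
  have h' : ∑' p : X × Y, (if P p then ENNReal.ofReal (u p.1) * ENNReal.ofReal (v p.2) else 0) =
      ∑' p : {p // P p}, ENNReal.ofReal (u p.1.1) * ENNReal.ofReal (v p.1.2) := by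
    refine Eq.trans (tsum_congr fun p => ?_) h.symm
    simp [Set.indicator]
  rw [h', ENNReal.tsum_toReal_eq fun p => ENNReal.mul_ne_top ENNReal.ofReal_ne_top
    ENNReal.ofReal_ne_top]
  refine tsum_congr fun p => ?_
  rw [ENNReal.toReal_mul, ENNReal.toReal_ofReal (hu _), ENNReal.toReal_ofReal (hv _)]

lemma ofReal_prod_inv_pow {r : ℕ} (s : Fin r → ℕ) (f : Fin r → ℕ+) :
    ENNReal.ofReal (∏ i, ((f i : ℝ) ^ s i)⁻¹) = ∏ i, invPow (s i) (f i) :=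
  ENNReal.ofReal_prod_of_nonneg fun i _ => by positivity

lemma ZU_cons_replicate (a : ℕ) (l : List ℕ) (n : ℕ) :
    ZU (a :: l) (List.replicate n 2) = (nestedSum (a :: l) 0 (lowerStar n)).toReal := by
  classical
  have hs (j : Fin (List.replicate n 2).length) : (List.replicate n 2).get j = 2 := by simp
  have hn : (List.replicate n 2).length = n := List.length_replicate
  unfold ZU
  generalize (List.replicate n 2).get = s at hs ⊢
  generalize (List.replicate n 2).length = m at s hs hn ⊢
  subst hn
  obtain rfl : s = fun _ => 2 := funext hs
  refine (tsum_subtype_mul_toReal _ (fun f : Fin (a :: l).length → ℕ+ =>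
    ∏ i, ((f i : ℝ) ^ (a :: l).get i)⁻¹) (fun g : Fin m → ℕ+ => ∏ i, ((g i : ℝ) ^ 2)⁻¹)
    (fun f => Finset.prod_nonneg fun i _ => by positivity)
    (fun f => Finset.prod_nonneg fun i _ => by positivity)).trans (congrArg _ ?_)
  rw [nestedSum]
  refine tsum_congr fun f => ?_
  have hlast : consTuple 0 f (Fin.last (a :: l).length) = (f (Fin.last l.length) : ℕ) := rfl
  simp only [hlast, strictMono_consTuple_zero, ← lowerStar_eq_tsum_monotone]
  by_cases hf : StrictMono f
  · rw [if_pos hf, ← ENNReal.tsum_mul_left]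
    refine tsum_congr fun g => ?_
    rw [ofReal_prod_inv_pow, ofReal_prod_inv_pow, mul_ite, mul_zero]
    congr 1
    refine propext ?_
    constructor
    · rintro ⟨-, h1, h2⟩
      exact ⟨h1, fun j hj => h2 j hj _ rfl⟩
    · rintro ⟨h1, h2⟩
      refine ⟨hf, h1, fun j hj i hi => ?_⟩
      obtain rfl : i = Fin.last l.length := Fin.ext hi
      exact h2 j hj
  · rw [if_neg hf]
    exact ENNReal.tsum_eq_zero.2 fun g => if_neg fun h => hf h.1

lemma ZL_cons_replicate (c : ℕ) (l : List ℕ) (n : ℕ) :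
    ZL ((c + 1) :: l) (List.replicate n 2) =
      (∑' k, appendList l (fun k => invPow (c + 1) k * upperStar n k) k).toReal := by
  classical
  have hs (j : Fin (List.replicate n 2).length) : (List.replicate n 2).get j = 2 := by simp
  have hn : (List.replicate n 2).length = n := List.length_replicate
  unfold ZL
  generalize (List.replicate n 2).get = s at hs ⊢
  generalize (List.replicate n 2).length = m at s hs hn ⊢
  subst hn
  obtain rfl : s = fun _ => 2 := funext hs
  refine (tsum_subtype_mul_toReal _ (fun f : Fin ((c + 1) :: l).length → ℕ+ =>
    ∏ i, ((f i : ℝ) ^ ((c + 1) :: l).get i)⁻¹) (fun g : Fin m → ℕ+ => ∏ i, ((g i : ℝ) ^ 2)⁻¹)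
    (fun f => Finset.prod_nonneg fun i _ => by positivity)
    (fun f => Finset.prod_nonneg fun i _ => by positivity)).trans (congrArg _ ?_)
  have hfold := tsum_mul_nestedSum l (fun k => invPow (c + 1) k * upperStar m k) (fun _ => 1)
  simp_rw [mul_one] at hfold
  rw [← hfold, ← tsum_pnat_eq_tsum _ (by simp [invPow_succ_zero])]
  refine (tsum_fin_succ_pnat (r := l.length) _).trans (tsum_congr fun k => ?_)
  rw [nestedSum, ← ENNReal.tsum_mul_left]
  refine tsum_congr fun f => ?_
  simp only [← strictMono_cons_iff]
  by_cases hf : StrictMono (Fin.cons k f : Fin (l.length + 1) → ℕ+)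
  · rw [if_pos hf, mul_one, upperStar_eq]
    have hprod : ∏ i : Fin (l.length + 1), invPow (((c + 1) :: l).get i)
        ((Fin.cons k f : Fin (l.length + 1) → ℕ+) i) =
        invPow (c + 1) k * ∏ i, invPow (l.get i) (f i) := by
      rw [Fin.prod_univ_succ]
      rfl
    rw [mul_right_comm, ← hprod, ← ENNReal.tsum_mul_left]
    refine tsum_congr fun g => ?_
    rw [ofReal_prod_inv_pow, ofReal_prod_inv_pow, mul_ite, mul_zero]
    congr 1
    refine propext ?_
    rw [monotone_consTuple]
    constructor
    · rintro ⟨-, h1, h2⟩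
      exact ⟨h1, fun j hj => h2 (0 : Fin (l.length + 1)) rfl j hj⟩
    · rintro ⟨h1, h2⟩
      refine ⟨hf, h1, fun i hi j hj => ?_⟩
      obtain rfl : i = (0 : Fin (l.length + 1)) := Fin.ext hi
      exact h2 j hj
  · rw [if_neg hf, mul_zero]
    exact ENNReal.tsum_eq_zero.2 fun g => if_neg fun h => hf h.1

lemma appendExp_zero (a : ℕ) (p : ℕ → ℝ≥0∞) : appendExp a p 0 = 0 := by simp [appendExp]

lemma iterate_succ_appendExp_zero (i : ℕ) (p : ℕ → ℝ≥0∞) : (appendExp 1)^[i + 1] p 0 = 0 := by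
  rw [Function.iterate_succ_apply', appendExp_zero]

lemma iterate_raiseExp_apply (i : ℕ) (p : ℕ → ℝ≥0∞) (k : ℕ) :
    raiseExp^[i] p k = invPow i k * p k := by
  induction i with
  | zero => simp [invPow]
  | succ i ih => rw [Function.iterate_succ_apply', raiseExp, ih, add_comm, invPow_add, mul_assoc]

lemma appendExp_add_two (b : ℕ) (p : ℕ → ℝ≥0∞) :
    appendExp (b + 2) p = raiseExp^[b + 1] (appendExp 1 p) := by
  ext k
  rw [iterate_raiseExp_apply, appendExp, appendExp, invPow_add (b + 1) 1, mul_assoc]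

lemma appendList_append (l l' : List ℕ) (p : ℕ → ℝ≥0∞) :
    appendList (l ++ l') p = appendList l' (appendList l p) := List.foldl_append

lemma appendList_replicate_one (a : ℕ) (p : ℕ → ℝ≥0∞) :
    appendList (List.replicate a 1) p = (appendExp 1)^[a] p := by
  induction a generalizing p with
  | zero => rfl
  | succ a ih => exact ih _

lemma appendList_block (a b : ℕ) (p : ℕ → ℝ≥0∞) :
    appendList (List.replicate a 1 ++ [b + 2]) p =
      raiseExp^[b + 1] ((appendExp 1)^[a + 1] p) := by
  rw [appendList_append, appendList_replicate_one, Function.iterate_succ_apply' (appendExp 1),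
    ← appendExp_add_two]
  rfl

lemma connectedSum_iterate_appendExp (i : ℕ) (p q : ℕ → ℝ≥0∞) (hq : q 0 = 0) :
    connectedSum ((appendExp 1)^[i] p) q = connectedSum p (raiseExp^[i] q) := by
  induction i generalizing q with
  | zero => rfl
  | succ i ih =>
    rw [Function.iterate_succ_apply', connectedSum_appendExp _ _ hq, ih _ (by simp [raiseExp, hq]),
      ← Function.iterate_succ_apply]

lemma connectedSum_iterate_raiseExp (i : ℕ) (p q : ℕ → ℝ≥0∞) (hp : p 0 = 0) :
    connectedSum (raiseExp^[i] p) q = connectedSum p ((appendExp 1)^[i] q) := by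
  rw [connectedSum_comm, ← connectedSum_iterate_appendExp i q p hp, connectedSum_comm]

lemma connectedSum_appendList_blocks (L : List (ℕ × ℕ)) (p q : ℕ → ℝ≥0∞) :
    connectedSum
        (appendList (L.map fun x => List.replicate x.1 1 ++ [x.2 + 2]).flatten p) q =
      connectedSum p
        (appendList (L.reverse.map fun x => List.replicate x.2 1 ++ [x.1 + 2]).flatten q) := by
  induction L generalizing p with
  | nil => rfl
  | cons x L ih =>
    rw [List.map_cons, List.flatten_cons, appendList_append _ (List.flatten _), ih, List.reverse_cons, List.map_append,
      List.flatten_append, List.map_singleton, List.flatten_singleton,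
      appendList_append (List.flatten _), appendList_block, appendList_block,
      connectedSum_iterate_raiseExp _ _ _ (iterate_succ_appendExp_zero _ _),
      connectedSum_iterate_appendExp _ _ _ (iterate_succ_appendExp_zero _ _)]

lemma tsum_pi_single_mul (F : ℕ → ℝ≥0∞) : ∑' k, (Pi.single 0 1 : ℕ → ℝ≥0∞) k * F k = F 0 := by
  rw [tsum_eq_single 0 fun k hk => by simp [hk]]
  simp

lemma connectedSum_single_zero (q : ℕ → ℝ≥0∞) :
    connectedSum (Pi.single 0 1) q = ∑' m, q m := by
  simp_rw [connectedSum, mul_assoc, ENNReal.tsum_mul_left]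
  rw [tsum_pi_single_mul]
  simp_rw [econn_comm 0, econn_zero_right, mul_one]

lemma ZL_block_append (a b : ℕ) (l : List ℕ) (n : ℕ) :
    ZL (List.replicate b 1 ++ [a + 2] ++ l) (List.replicate n 2) =
      (∑' k, appendList l
        (raiseExp^[a + 1] ((appendExp 1)^[b] (raiseExp (upperStar n)))) k).toReal := by
  cases b with
  | zero =>
    have h := ZL_cons_replicate (a + 1) l n
    simp_rw [← iterate_raiseExp_apply] at h
    exact h
  | succ b =>
    have h := ZL_cons_replicate 0 (List.replicate b 1 ++ [a + 2] ++ l) n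
    rw [appendList_append, appendList_block] at h
    exact h

lemma ZU_append_block (a b : ℕ) (l : List ℕ) (n : ℕ) :
    ZU (l ++ (List.replicate a 1 ++ [b + 2])) (List.replicate n 2) =
      (connectedSum (appendList l (Pi.single 0 1))
        (raiseExp^[a + 1] ((appendExp 1)^[b] (raiseExp (upperStar n))))).toReal := by
  have h : ZU (l ++ (List.replicate a 1 ++ [b + 2])) (List.replicate n 2) =
      (nestedSum (l ++ (List.replicate a 1 ++ [b + 2])) 0 (lowerStar n)).toReal := by
    obtain ⟨c, l', hl⟩ := List.exists_cons_of_ne_nil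
      (show l ++ (List.replicate a 1 ++ [b + 2]) ≠ [] by simp)
    rw [hl, ZU_cons_replicate]
  have hz (p : ℕ → ℝ≥0∞) : raiseExp^[b] ((appendExp 1)^[a + 1] p) 0 = 0 := by
    rw [iterate_raiseExp_apply, iterate_succ_appendExp_zero, mul_zero]
  have hz' : (appendExp 1)^[b] (raiseExp (upperStar n)) 0 = 0 := by
    cases b with
    | zero => simp [raiseExp, invPow_succ_zero 0]
    | succ b => exact iterate_succ_appendExp_zero _ _
  rw [h, ← tsum_pi_single_mul fun k => nestedSum _ k _, tsum_mul_nestedSum, appendList_append,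
    appendList_block, Function.iterate_succ_apply', tsum_raiseExp_mul_lowerStar _ (hz _),
    connectedSum_iterate_raiseExp _ _ _ (iterate_succ_appendExp_zero _ _),
    connectedSum_iterate_appendExp _ _ _ hz']

lemma ZU_nil_eq_ZL_nil (l : List ℕ) : ZU [] l = ZL [] l := by
  unfold ZU ZL
  have h : (fun p : (Fin ([] : List ℕ).length → ℕ+) × (Fin l.length → ℕ+) =>
      StrictMono p.1 ∧ Monotone p.2 ∧ ∀ j : Fin l.length, (j : ℕ) = l.length - 1 →
        ∀ i : Fin ([] : List ℕ).length, (i : ℕ) = ([] : List ℕ).length - 1 → p.2 j ≤ p.1 i) =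
      fun p => StrictMono p.1 ∧ Monotone p.2 ∧ ∀ i : Fin ([] : List ℕ).length, (i : ℕ) = 0 →
        ∀ j : Fin l.length, (j : ℕ) = 0 → p.1 i ≤ p.2 j := by
    ext p
    exact and_congr_right' (and_congr_right'
      (iff_of_true (fun _ _ i => i.elim0) fun i => i.elim0))
  exact (Equiv.subtypeEquivProp h).tsum_eq
    fun p => (∏ i, ((p.1.1 i : ℝ) ^ (([] : List ℕ).get i))⁻¹) * ∏ j, ((p.1.2 j : ℝ) ^ (l.get j))⁻¹

/-- Duality theorem for `Z_U` and `Z_L` (Theorem 1.3 / 4.1):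
if `β` is the dual index of the admissible index `α`, then
`Z_U(α; {2}ⁿ) = Z_L(β; {2}ⁿ)` for every nonnegative integer `n`. -/
theorem stmt_4 (L : List (ℕ × ℕ)) (n : ℕ)
    (α β : List ℕ)
    (hαdef : α = (L.map (fun p => List.replicate p.1 1 ++ [p.2 + 2])).flatten)
    (hβdef : β = (L.reverse.map (fun p => List.replicate p.2 1 ++ [p.1 + 2])).flatten) :
    ZU α (List.replicate n 2) = ZL β (List.replicate n 2) := by
  subst hαdef hβdef
  rcases L.eq_nil_or_concat' with rfl | ⟨L, ⟨a, b⟩, rfl⟩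
  · exact ZU_nil_eq_ZL_nil _
  · rw [List.map_append, List.flatten_append, List.map_singleton, List.flatten_singleton,
      List.reverse_append, List.map_append, List.flatten_append, List.reverse_singleton,
      List.map_singleton, List.flatten_singleton, ZU_append_block, ZL_block_append,
      connectedSum_appendList_blocks, connectedSum_single_zero]
end

section
/- Let α = ({1}^{a_1}, b_1+2, {1}^{a_2}, b_2+2, …, {1}^{a_n}, b_n+2) be an admissible index with dual index β = ({1}^{b_n}, a_n+2, {1}^{b_{n-1}}, a_{n-1}+2, …, {1}^{b_1}, a_1+2), where (a_1,b_1),…,(a_n,b_n) are pairs of nonnegative integers. Then for every nonnegative integer n one has Z_B(α; {2}^n) = Z_B(β; {2}^n). -/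
open scoped BigOperators

open scoped ENNReal

namespace ZBDuality

/-! ### The operators attached to the two letters of a word -/

/-- The reciprocal of a positive integer as an extended nonnegative real. -/
noncomputable def recip (m : ℕ+) : ℝ≥0∞ := ((m : ℕ) : ℝ≥0∞)⁻¹

/-- The operator of a letter: `true` divides by the argument, `false` divides the partial sums
by the argument. -/
noncomputable def letterOp : Bool → (ℕ+ → ℝ≥0∞) → ℕ+ → ℝ≥0∞
  | true, f, m => recip m * f m
  | false, f, m => recip m * ∑' k, if k < m then f k else 0

/-- The adjoint of `letterOp` for the pairing `∑' m, f m * φ m`. -/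
noncomputable def letterAdj : Bool → (ℕ+ → ℝ≥0∞) → ℕ+ → ℝ≥0∞
  | true, φ, m => recip m * φ m
  | false, φ, k => ∑' m, if k < m then recip m * φ m else 0

/-- The operator of a word, the first letter acting first. -/
noncomputable def wordOp (W : List Bool) (f : ℕ+ → ℝ≥0∞) : ℕ+ → ℝ≥0∞ :=
  W.foldl (fun g l => letterOp l g) f

/-- The adjoint of `wordOp`. -/
noncomputable def wordAdj (W : List Bool) (φ : ℕ+ → ℝ≥0∞) : ℕ+ → ℝ≥0∞ :=
  W.foldr letterAdj φ

/-- The dual word: reverse the word and exchange the letters. -/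
def dualWord (W : List Bool) : List Bool := W.reverse.map not

/-- The connector `m! n! / (m + n)!`. -/
noncomputable def conn (m n : ℕ) : ℝ := (m.factorial * n.factorial : ℝ) / (m + n).factorial

lemma conn_comm (m n : ℕ) : conn m n = conn n m := by
  simp only [conn, mul_comm, add_comm]

lemma conn_pos (m n : ℕ) : 0 < conn m n := by unfold conn; positivity

lemma conn_zero_right (m : ℕ) : conn m 0 = 1 := by
  have : (m.factorial : ℝ) ≠ 0 := by positivity
  simp [conn, this]

lemma conn_succ_right (m n : ℕ) : conn m (n + 1) * (m + n + 1) = (n + 1) * conn m n := by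
  have h : (((m + n).factorial : ℕ) : ℝ) ≠ 0 := by positivity
  rw [conn, conn, ← add_assoc, Nat.factorial_succ, Nat.factorial_succ]
  push_cast
  field_simp

lemma conn_succ_left (m n : ℕ) : conn (m + 1) n * (m + n + 1) = (m + 1) * conn m n := by
  have := conn_succ_right n m
  rw [conn_comm (m + 1), conn_comm m]
  linarith [this]

lemma conn_succ_right_le (m n : ℕ) : conn m (n + 1) ≤ conn m n := by
  have h := conn_succ_right m n
  have hm : (0 : ℝ) ≤ m := by positivity
  have hn : (0 : ℝ) ≤ n := by positivity
  nlinarith [mul_nonneg hm (conn_pos m (n + 1)).le]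

lemma conn_one_right (m : ℕ) : conn m 1 = 1 / (m + 1) := by
  have h := conn_succ_right m 0
  rw [conn_zero_right] at h
  have : (m : ℝ) + 1 ≠ 0 := by positivity
  field_simp
  push_cast at h
  linarith

lemma conn_le_one_div (m n : ℕ) (hn : 1 ≤ n) : conn m n ≤ 1 / (m + 1) := by
  induction n, hn using Nat.le_induction with
  | base => rw [conn_one_right]
  | succ n _ ih => exact (conn_succ_right_le m n).trans ih

lemma tendsto_conn {n : ℕ} (hn : 1 ≤ n) :
    Filter.Tendsto (fun m => conn m n) Filter.atTop (nhds 0) :=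
  squeeze_zero (fun m => (conn_pos m n).le) (fun m => conn_le_one_div m n hn)
    tendsto_one_div_add_atTop_nhds_zero_nat

lemma hasSum_conn (m n : ℕ) (hn : 1 ≤ n) :
    HasSum (fun i : ℕ => conn (m + i + 1) n / (m + i + 1)) (conn m n / n) := by
  have hn' : (n : ℝ) ≠ 0 := by positivity
  rw [hasSum_iff_tendsto_nat_of_nonneg (fun i => by have := conn_pos (m+i+1) n; positivity)]
  have key : ∀ N : ℕ, ∑ i ∈ Finset.range N, conn (m + i + 1) n / ((m : ℝ) + i + 1)
      = (conn m n - conn (m + N) n) / n := by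
    intro N
    induction N with
    | zero => simp
    | succ N ih =>
      rw [Finset.sum_range_succ, ih]
      have h := conn_succ_left (m + N) n
      push_cast at h
      have h3 : ((m : ℝ) + N + 1) ≠ 0 := by positivity
      rw [← add_assoc]
      field_simp
      linarith
  simp_rw [key]
  have h := ((tendsto_conn hn).comp (Filter.tendsto_add_atTop_nat m))
  have h2 := (h.const_sub (conn m n)).div_const (n : ℝ)
  simpa [Function.comp_def, add_comm] using h2

/-- The connector as a kernel with extended nonnegative values. -/
noncomputable def kernel (m n : ℕ+) : ℝ≥0∞ := ENNReal.ofReal (conn m n)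

lemma kernel_comm (m n : ℕ+) : kernel m n = kernel n m := by rw [kernel, kernel, conn_comm]

lemma recip_eq_ofReal (m : ℕ+) : recip m = ENNReal.ofReal (m : ℝ)⁻¹ := by
  rw [ENNReal.ofReal_inv_of_pos (by positivity)]
  simp [recip]

lemma tsum_if_lt (k : ℕ+) (u : ℕ+ → ℝ≥0∞) :
    (∑' m, if k < m then u m else 0) = ∑' i : ℕ, u (k + i.succPNat) := by
  have hinj : Function.Injective (fun i : ℕ => k + i.succPNat) := by
    intro i j h
    simpa using h
  rw [← hinj.tsum_eq (f := fun m => if k < m then u m else 0)]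
  · refine tsum_congr fun i => if_pos ?_
    exact PNat.lt_add_right k _
  · intro m hm
    have hlt : k < m := by
      by_contra h
      simp [h] at hm
    refine ⟨(m - k).natPred, ?_⟩
    simp [PNat.add_sub_of_lt hlt]

lemma letterAdj_false_kernel (m n : ℕ+) :
    (∑' j, if m < j then recip j * kernel j n else 0) = recip n * kernel m n := by
  rw [tsum_if_lt]
  have h := hasSum_conn m n n.pos
  have h' := (ENNReal.ofReal_tsum_of_nonneg
    (fun i => by have := conn_pos (m + i + 1) n; positivity) h.summable)
  rw [h.tsum_eq] at h'
  rw [recip_eq_ofReal, kernel, ← ENNReal.ofReal_mul (by positivity),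
    mul_comm, ← div_eq_mul_inv, h']
  refine tsum_congr fun i => ?_
  rw [recip_eq_ofReal, kernel, ← ENNReal.ofReal_mul (by positivity), mul_comm, ← div_eq_mul_inv]
  simp [add_assoc]

lemma tsum_letterOp_mul (l : Bool) (f φ : ℕ+ → ℝ≥0∞) :
    ∑' m, letterOp l f m * φ m = ∑' m, f m * letterAdj l φ m := by
  cases l
  · simp only [letterOp, letterAdj, ← ENNReal.tsum_mul_left, ← ENNReal.tsum_mul_right]
    rw [ENNReal.tsum_comm]
    refine tsum_congr fun k => tsum_congr fun m => ?_
    split_ifs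
    · ring
    · simp
  · exact tsum_congr fun m => by simp only [letterOp, letterAdj]; ring

lemma tsum_wordOp_mul (W : List Bool) (f φ : ℕ+ → ℝ≥0∞) :
    ∑' m, wordOp W f m * φ m = ∑' m, f m * wordAdj W φ m := by
  induction W generalizing f with
  | nil => rfl
  | cons l W ih =>
    change ∑' m, wordOp W (letterOp l f) m * φ m = ∑' m, f m * letterAdj l (wordAdj W φ) m
    rw [ih, tsum_letterOp_mul]

/-- The connected sum of two functions. -/
noncomputable def connSum (f g : ℕ+ → ℝ≥0∞) : ℝ≥0∞ :=
  ∑' m, f m * ∑' n, g n * kernel m n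

lemma connSum_comm (f g : ℕ+ → ℝ≥0∞) : connSum f g = connSum g f := by
  simp only [connSum, ← ENNReal.tsum_mul_left]
  rw [ENNReal.tsum_comm]
  refine tsum_congr fun m => tsum_congr fun n => ?_
  rw [kernel_comm]
  ring

lemma connSum_letterOp_false (f g : ℕ+ → ℝ≥0∞) :
    connSum (letterOp false f) g = connSum f (letterOp true g) := by
  have hfun : ∀ m, letterAdj false (fun m => ∑' n, g n * kernel m n) m
      = ∑' n, letterOp true g n * kernel m n := by
    intro m
    simp only [letterAdj, letterOp]
    calc _ = ∑' j, ∑' n, (g n * if m < j then recip j * kernel j n else 0) := by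
          refine tsum_congr fun j => ?_
          split_ifs
          · rw [← ENNReal.tsum_mul_left]
            exact tsum_congr fun n => by ring
          · simp
      _ = _ := by
          rw [ENNReal.tsum_comm]
          refine tsum_congr fun n => ?_
          rw [ENNReal.tsum_mul_left, letterAdj_false_kernel]
          ring
  rw [connSum, tsum_letterOp_mul]
  exact tsum_congr fun m => by rw [hfun]

lemma connSum_letterOp (l : Bool) (f g : ℕ+ → ℝ≥0∞) :
    connSum (letterOp l f) g = connSum f (letterOp (!l) g) := by
  cases l
  · exact connSum_letterOp_false f g
  · rw [connSum_comm, connSum_comm f]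
    exact (connSum_letterOp_false g f).symm

lemma connSum_wordOp (W : List Bool) (f g : ℕ+ → ℝ≥0∞) :
    connSum (wordOp W f) g = connSum f (wordOp (dualWord W) g) := by
  induction W generalizing f with
  | nil => rfl
  | cons l W ih =>
    change connSum (wordOp W (letterOp l f)) g = _
    rw [ih, connSum_letterOp]
    simp [wordOp, dualWord]


/-! ### The boundary relation -/

/-- The product `∏_{ℓ ≤ m} (1 - t / ℓ²)`. -/
noncomputable def partialProd (t : ℝ) (m : ℕ) : ℝ :=
  ∏ i ∈ Finset.range m, (1 - t / ((i : ℝ) + 1) ^ 2)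

lemma one_sub_div_sq_pos {t : ℝ} (ht0 : 0 ≤ t) (ht1 : t < 1) (i : ℕ) :
    0 < 1 - t / ((i : ℝ) + 1) ^ 2 := by
  have h : t / ((i : ℝ) + 1) ^ 2 ≤ t :=
    div_le_self ht0 (one_le_pow₀ (by linarith [(Nat.cast_nonneg i : (0 : ℝ) ≤ i)]))
  linarith

lemma partialProd_pos {t : ℝ} (ht0 : 0 ≤ t) (ht1 : t < 1) (m : ℕ) : 0 < partialProd t m :=
  Finset.prod_pos fun i _ => one_sub_div_sq_pos ht0 ht1 i

lemma partialProd_le_one {t : ℝ} (ht0 : 0 ≤ t) (ht1 : t < 1) (m : ℕ) : partialProd t m ≤ 1 := by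
  refine Finset.prod_le_one (fun i _ => (one_sub_div_sq_pos ht0 ht1 i).le) fun i _ => ?_
  have : 0 ≤ t / ((i : ℝ) + 1) ^ 2 := by positivity
  linarith

lemma partialProd_succ (t : ℝ) (m : ℕ) :
    partialProd t (m + 1) = partialProd t m * (1 - t / ((m : ℝ) + 1) ^ 2) :=
  Finset.prod_range_succ _ _

/-- The terms of the hypergeometric series attached to the connector. -/
noncomputable def hyperTerm (t : ℝ) (n a : ℕ) : ℝ :=
  partialProd t a * conn (a + 1) n / (a + 1)

lemma hyperTerm_pos {t : ℝ} (ht0 : 0 ≤ t) (ht1 : t < 1) (n a : ℕ) : 0 < hyperTerm t n a := by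
  have := conn_pos (a + 1) n
  have := partialProd_pos ht0 ht1 a
  unfold hyperTerm
  positivity

lemma mul_hyperTerm_le {t : ℝ} (ht0 : 0 ≤ t) (ht1 : t < 1) (n a : ℕ) :
    (a + 1) * hyperTerm t n a ≤ conn (a + 1) n := by
  have h : ((a : ℝ) + 1) * hyperTerm t n a = partialProd t a * conn (a + 1) n := by
    unfold hyperTerm
    field_simp
  rw [h]
  exact mul_le_of_le_one_left (conn_pos _ _).le (partialProd_le_one ht0 ht1 a)

lemma summable_hyperTerm {t : ℝ} (ht0 : 0 ≤ t) (ht1 : t < 1) {n : ℕ} (hn : 1 ≤ n) :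
    Summable (hyperTerm t n) := by
  have hs : Summable fun a : ℕ => 1 / ((a + 1 : ℕ) : ℝ) ^ 2 :=
    (summable_nat_add_iff 1).2 (Real.summable_one_div_nat_pow.2 one_lt_two)
  refine Summable.of_nonneg_of_le (fun a => (hyperTerm_pos ht0 ht1 n a).le) (fun a => ?_) hs
  have h1 := mul_hyperTerm_le ht0 ht1 n a
  have h2 := conn_le_one_div (a + 1) n hn
  have h3 : 1 / (((a + 1 : ℕ) : ℝ) + 1) ≤ 1 / ((a : ℝ) + 1) := by
    apply one_div_le_one_div_of_le (by positivity)
    push_cast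
    linarith
  have h4 : ((a : ℝ) + 1) * hyperTerm t n a ≤ 1 / ((a : ℝ) + 1) := h1.trans (h2.trans h3)
  rw [le_div_iff₀ (by positivity)] at h4 ⊢
  push_cast
  linarith

lemma hyperTerm_telescope (t : ℝ) (n a : ℕ) :
    n * (n + 1) * hyperTerm t n a - ((n + 1) ^ 2 - t) * hyperTerm t (n + 1) a
      = (n + 1) * a * hyperTerm t n a - (n + 1) * (a + 1) * hyperTerm t n (a + 1) := by
  have h1 := conn_succ_right (a + 1) n
  have h2 := conn_succ_left (a + 1) n
  have hd : ((a : ℝ) + 1 + n + 1) ≠ 0 := by positivity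
  have hd2 : ((a : ℝ) + 1 + 1) ≠ 0 := by positivity
  push_cast at h1 h2
  rw [← eq_div_iff hd] at h1 h2
  rw [hyperTerm, hyperTerm, hyperTerm, h1, h2, partialProd_succ]
  push_cast
  field_simp
  ring

lemma tsum_hyperTerm_succ {t : ℝ} (ht0 : 0 ≤ t) (ht1 : t < 1) {n : ℕ} (hn : 1 ≤ n) :
    ((n + 1) ^ 2 - t) * ∑' a, hyperTerm t (n + 1) a = n * (n + 1) * ∑' a, hyperTerm t n a := by
  have s1 := (summable_hyperTerm ht0 ht1 hn).hasSum.mul_left ((n : ℝ) * (n + 1))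
  have s2 := (summable_hyperTerm ht0 ht1 (n := n + 1) (by omega)).hasSum.mul_left
    (((n : ℝ) + 1) ^ 2 - t)
  have h := (s1.sub s2).tendsto_sum_nat
  have key : ∀ N : ℕ, ∑ a ∈ Finset.range N,
      (n * (n + 1) * hyperTerm t n a - ((n + 1) ^ 2 - t) * hyperTerm t (n + 1) a)
      = - ((n + 1) * N * hyperTerm t n N) := by
    intro N
    induction N with
    | zero => simp
    | succ N ih =>
      rw [Finset.sum_range_succ, ih, hyperTerm_telescope]
      push_cast
      ring
  simp_rw [key] at h
  have hc : Filter.Tendsto (fun N : ℕ => ((n : ℝ) + 1) * conn (N + 1) n) Filter.atTop (nhds 0) := by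
    simpa using ((tendsto_conn hn).comp (Filter.tendsto_add_atTop_nat 1)).const_mul ((n : ℝ) + 1)
  have h0 : Filter.Tendsto (fun N : ℕ => ((n : ℝ) + 1) * N * hyperTerm t n N)
      Filter.atTop (nhds 0) := by
    refine squeeze_zero (fun N => ?_) (fun N => ?_) hc
    · have := hyperTerm_pos ht0 ht1 n N
      positivity
    · have h1 := mul_hyperTerm_le ht0 ht1 n N
      have h2 := hyperTerm_pos ht0 ht1 n N
      rw [mul_assoc]
      gcongr
      linarith
  have := tendsto_nhds_unique h h0.neg
  linarith

/-- The constant in the boundary relation. -/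
noncomputable def boundaryConst (t : ℝ) : ℝ := partialProd t 1 * ∑' a, hyperTerm t 1 a

lemma boundaryConst_pos {t : ℝ} (ht0 : 0 ≤ t) (ht1 : t < 1) : 0 < boundaryConst t :=
  mul_pos (partialProd_pos ht0 ht1 1)
    ((summable_hyperTerm ht0 ht1 le_rfl).tsum_pos (fun a => (hyperTerm_pos ht0 ht1 1 a).le) 0
      (hyperTerm_pos ht0 ht1 1 0))

lemma mul_tsum_hyperTerm {t : ℝ} (ht0 : 0 ≤ t) (ht1 : t < 1) {n : ℕ} (hn : 1 ≤ n) :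
    n * partialProd t n * ∑' a, hyperTerm t n a = boundaryConst t := by
  induction n, hn using Nat.le_induction with
  | base => simp [boundaryConst]
  | succ n hn ih =>
    have h := tsum_hyperTerm_succ ht0 ht1 hn
    rw [← ih, partialProd_succ]
    push_cast
    have hq : (n + 1 : ℝ) * (1 - t / ((n : ℝ) + 1) ^ 2) = ((n + 1) ^ 2 - t) / (n + 1) := by
      field_simp
    calc (n + 1 : ℝ) * (partialProd t n * (1 - t / ((n : ℝ) + 1) ^ 2))
          * ∑' a, hyperTerm t (n + 1) a
        = partialProd t n * ((n + 1 : ℝ) * (1 - t / ((n : ℝ) + 1) ^ 2))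
          * ∑' a, hyperTerm t (n + 1) a := by ring
      _ = partialProd t n * (((n + 1) ^ 2 - t) * ∑' a, hyperTerm t (n + 1) a) / (n + 1) := by
          rw [hq]; ring
      _ = _ := by rw [h]; field_simp

/-- The weight of the smallest summation variable. -/
noncomputable def startWeight (t : ℝ) (m : ℕ+) : ℝ≥0∞ :=
  ENNReal.ofReal (partialProd t m.natPred)

/-- The weight of the largest summation variable. -/
noncomputable def endWeight (t : ℝ) (m : ℕ+) : ℝ≥0∞ := ENNReal.ofReal (partialProd t m)⁻¹

lemma tsum_startWeight_mul_kernel {t : ℝ} (ht0 : 0 ≤ t) (ht1 : t < 1) (m : ℕ+) :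
    ∑' n, recip n * startWeight t n * kernel m n
      = ENNReal.ofReal (boundaryConst t) * (recip m * endWeight t m) := by
  have hp := partialProd_pos ht0 ht1 m
  have hT : boundaryConst t * ((m : ℝ)⁻¹ * (partialProd t m)⁻¹) = ∑' a, hyperTerm t m a := by
    rw [← mul_tsum_hyperTerm ht0 ht1 m.pos]
    have : (m : ℝ) ≠ 0 := by positivity
    field_simp
  rw [recip_eq_ofReal, endWeight, ← ENNReal.ofReal_mul (by positivity),
    ← ENNReal.ofReal_mul (boundaryConst_pos ht0 ht1).le, hT,
    ENNReal.ofReal_tsum_of_nonneg (fun a => (hyperTerm_pos ht0 ht1 m a).le)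
      (summable_hyperTerm ht0 ht1 m.pos), ← Equiv.pnatEquivNat.symm.tsum_eq]
  refine tsum_congr fun a => ?_
  have := partialProd_pos ht0 ht1 a
  rw [recip_eq_ofReal, startWeight, kernel, ← ENNReal.ofReal_mul (by positivity),
    ← ENNReal.ofReal_mul (by simp; positivity), conn_comm]
  congr 1
  simp [hyperTerm]
  field_simp

/-- The sum attached to the word `false :: W ++ [true]`. -/
noncomputable def wordSum (t : ℝ) (W : List Bool) : ℝ≥0∞ :=
  ∑' m, recip m * startWeight t m * wordAdj W (fun n => recip n * endWeight t n) m

lemma boundaryConst_mul_wordSum {t : ℝ} (ht0 : 0 ≤ t) (ht1 : t < 1) (W : List Bool) :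
    ENNReal.ofReal (boundaryConst t) * wordSum t W
      = connSum (wordOp W fun m => recip m * startWeight t m)
          (fun m => recip m * startWeight t m) := by
  rw [wordSum, ← tsum_wordOp_mul, connSum, ← ENNReal.tsum_mul_left]
  refine tsum_congr fun m => ?_
  rw [tsum_startWeight_mul_kernel ht0 ht1]
  ring

lemma wordSum_dualWord {t : ℝ} (ht0 : 0 ≤ t) (ht1 : t < 1) (W : List Bool) :
    wordSum t (dualWord W) = wordSum t W := by
  have h : ENNReal.ofReal (boundaryConst t) ≠ 0 := by
    simpa using boundaryConst_pos ht0 ht1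
  rw [← ENNReal.mul_right_inj h ENNReal.ofReal_ne_top, boundaryConst_mul_wordSum ht0 ht1,
    boundaryConst_mul_wordSum ht0 ht1, connSum_wordOp W, connSum_comm]

lemma recip_le_one (m : ℕ+) : recip m ≤ 1 := by
  rw [recip, ENNReal.inv_le_one]
  exact_mod_cast m.pos

lemma letterAdj_mono (l : Bool) {φ ψ : ℕ+ → ℝ≥0∞} (h : φ ≤ ψ) : letterAdj l φ ≤ letterAdj l ψ := by
  intro m
  cases l
  · refine ENNReal.tsum_le_tsum fun j => ?_
    split_ifs
    · exact mul_le_mul_right (h j) _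
    · exact le_rfl
  · exact mul_le_mul_right (h m) _

lemma wordAdj_le_filter (W : List Bool) (φ : ℕ+ → ℝ≥0∞) :
    wordAdj W φ ≤ wordAdj (W.filter not) φ := by
  induction W with
  | nil => exact le_rfl
  | cons l W ih =>
    cases l
    · exact letterAdj_mono false ih
    · intro m
      exact (mul_le_of_le_one_left zero_le (recip_le_one m)).trans (ih m)

lemma wordSum_le_filter (t : ℝ) (W : List Bool) : wordSum t W ≤ wordSum t (W.filter not) :=
  ENNReal.tsum_le_tsum fun m => mul_le_mul_right (wordAdj_le_filter W _ m) _

lemma wordSum_nil_ne_top {t : ℝ} (ht0 : 0 ≤ t) (ht1 : t < 1) : wordSum t [] ≠ ∞ := by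
  have hs : Summable fun a : ℕ => (1 - t)⁻¹ * (1 / ((a + 1 : ℕ) : ℝ) ^ 2) :=
    ((summable_nat_add_iff 1).2 (Real.summable_one_div_nat_pow.2 one_lt_two)).mul_left _
  have hpos : 0 < 1 - t := by linarith
  refine ne_top_of_le_ne_top (ENNReal.ofReal_ne_top
    (r := ∑' a : ℕ, (1 - t)⁻¹ * (1 / ((a + 1 : ℕ) : ℝ) ^ 2))) ?_
  rw [ENNReal.ofReal_tsum_of_nonneg (fun a => by positivity) hs, wordSum,
    ← Equiv.pnatEquivNat.symm.tsum_eq]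
  refine ENNReal.tsum_le_tsum fun a => ?_
  have h1 := partialProd_pos ht0 ht1 a
  have h2 := partialProd_pos ht0 ht1 (a + 1)
  simp only [wordAdj, List.foldr_nil, recip_eq_ofReal, startWeight, endWeight]
  simp only [Equiv.pnatEquivNat_symm_apply, Nat.natPred_succPNat, Nat.succPNat_coe,
    Nat.succ_eq_add_one]
  rw [← ENNReal.ofReal_mul (by positivity), ← ENNReal.ofReal_mul (by positivity),
    ← ENNReal.ofReal_mul (by positivity)]
  apply ENNReal.ofReal_le_ofReal
  rw [partialProd_succ]
  have h3 := one_sub_div_sq_pos ht0 ht1 a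
  have h4 : 1 - t ≤ 1 - t / ((a : ℝ) + 1) ^ 2 := by
    have h : t / ((a : ℝ) + 1) ^ 2 ≤ t :=
      div_le_self ht0 (one_le_pow₀ (by linarith [(Nat.cast_nonneg a : (0 : ℝ) ≤ a)]))
    linarith
  have h5 := inv_anti₀ hpos h4
  calc _ = (1 - t / ((a : ℝ) + 1) ^ 2)⁻¹ * (1 / ((a + 1 : ℕ) : ℝ) ^ 2) := by
        push_cast
        rw [mul_inv]
        generalize (1 - t / ((a : ℝ) + 1) ^ 2)⁻¹ = y
        field_simp
    _ ≤ _ := by gcongr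

lemma wordSum_ne_top {t : ℝ} (ht0 : 0 ≤ t) (ht1 : t < 1) (W : List Bool) : wordSum t W ≠ ∞ := by
  refine ne_top_of_le_ne_top (wordSum_nil_ne_top ht0 ht1) ((wordSum_le_filter t W).trans ?_)
  rw [← wordSum_dualWord ht0 ht1]
  refine (wordSum_le_filter t _).trans (le_of_eq ?_)
  congr 1
  simp [dualWord]

/-! ### Nested sums over tuples -/

lemma tsum_tuple_succ {r : ℕ} (F : (Fin (r + 1) → ℕ+) → ℝ≥0∞) :
    ∑' f, F f = ∑' (j : ℕ+) (f : Fin r → ℕ+), F (Matrix.vecCons j f) := by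
  rw [← (Fin.consEquiv fun _ : Fin (r + 1) => ℕ+).tsum_eq, ENNReal.tsum_prod']
  rfl

/-- The monomial `∏ i, (f i) ^ (-α i)`. -/
noncomputable def monomial (α : List ℕ) (f : Fin α.length → ℕ+) : ℝ≥0∞ :=
  ∏ i, recip (f i) ^ α.get i

lemma monomial_cons (a : ℕ) (α : List ℕ) (k : ℕ+) (f : Fin α.length → ℕ+) :
    monomial (a :: α) (Matrix.vecCons k f) = recip k ^ a * monomial α f :=
  Fin.prod_univ_succ (n := α.length)
    fun i => recip ((Matrix.vecCons k f : Fin (α.length + 1) → ℕ+) i) ^ (a :: α).get i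

open Classical in
/-- The sum of `φ (k_r) ∏ k_i ^ (-α_i)` over `k < k_1 < ⋯ < k_r`. -/
noncomputable def chainSum (φ : ℕ+ → ℝ≥0∞) (α : List ℕ) (k : ℕ+) : ℝ≥0∞ :=
  ∑' f : Fin α.length → ℕ+, if StrictMono (Matrix.vecCons k f) then
    monomial α f * φ (Matrix.vecCons k f (Fin.last _)) else 0

lemma chainSum_nil (φ : ℕ+ → ℝ≥0∞) (k : ℕ+) : chainSum φ [] k = φ k := by
  rw [chainSum]
  refine (tsum_eq_single (β := Fin 0 → ℕ+) ![]
    fun f hf => absurd (Subsingleton.elim f _) hf).trans ?_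
  rw [if_pos]
  · simp [monomial]
  · exact Subsingleton.strictMono (α := Fin 1) _

lemma chainSum_cons (φ : ℕ+ → ℝ≥0∞) (a : ℕ) (α : List ℕ) (k : ℕ+) :
    chainSum φ (a :: α) k = ∑' j, if k < j then recip j ^ a * chainSum φ α j else 0 := by
  classical
  rw [chainSum]
  refine (tsum_tuple_succ (r := α.length) _).trans (tsum_congr fun j => ?_)
  by_cases h : k < j
  · rw [if_pos h, chainSum, ← ENNReal.tsum_mul_left]
    refine tsum_congr fun f => ?_
    have hiff : StrictMono (Matrix.vecCons k (Matrix.vecCons j f))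
        ↔ StrictMono (Matrix.vecCons j f) := by
      rw [strictMono_vecCons]
      exact and_iff_right h
    rw [monomial_cons, mul_ite, mul_zero]
    refine if_congr hiff ?_ rfl
    rw [mul_assoc]
    rfl
  · rw [if_neg h]
    refine ENNReal.tsum_eq_zero.2 fun f => if_neg fun hf => h ?_
    exact (strictMono_vecCons.1 hf).1

open Classical in
/-- The sum of `∏ ℓ_j ^ (-β_j)` over `a ≤ ℓ_1 ≤ ⋯ ≤ ℓ_m ≤ b`. -/
noncomputable def starSum (β : List ℕ) (a b : ℕ+) : ℝ≥0∞ :=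
  ∑' g : Fin β.length → ℕ+,
    if Monotone (Matrix.vecCons a g) ∧ Matrix.vecCons a g (Fin.last _) ≤ b then
      monomial β g else 0

lemma starSum_nil {a b : ℕ+} (hab : a ≤ b) : starSum [] a b = 1 := by
  rw [starSum]
  refine (tsum_eq_single (β := Fin 0 → ℕ+) ![]
    fun f hf => absurd (Subsingleton.elim f _) hf).trans ?_
  rw [if_pos]
  · simp [monomial]
  · exact ⟨Subsingleton.monotone (α := Fin 1) _, hab⟩

lemma starSum_of_lt (β : List ℕ) {a b : ℕ+} (hab : b < a) : starSum β a b = 0 := by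
  classical
  refine ENNReal.tsum_eq_zero.2 fun g => if_neg fun hg => ?_
  have h : a ≤ Matrix.vecCons a g (Fin.last _) := hg.1 (Fin.zero_le _)
  exact absurd (h.trans hg.2) (not_le.2 hab)

lemma starSum_cons (c : ℕ) (β : List ℕ) (a b : ℕ+) :
    starSum (c :: β) a b = ∑' j, if a ≤ j then recip j ^ c * starSum β j b else 0 := by
  classical
  rw [starSum]
  refine (tsum_tuple_succ (r := β.length) _).trans (tsum_congr fun j => ?_)
  by_cases h : a ≤ j
  · rw [if_pos h, starSum, ← ENNReal.tsum_mul_left]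
    refine tsum_congr fun f => ?_
    have hiff : Monotone (Matrix.vecCons a (Matrix.vecCons j f))
        ↔ Monotone (Matrix.vecCons j f) := by
      rw [monotone_vecCons]
      exact and_iff_right h
    rw [monomial_cons, mul_ite, mul_zero]
    exact if_congr (and_congr hiff Iff.rfl) rfl rfl
  · rw [if_neg h]
    refine ENNReal.tsum_eq_zero.2 fun f => if_neg fun hf => h ?_
    exact (monotone_vecCons.1 hf.1).1

lemma starSum_cons_eq_add (c : ℕ) (β : List ℕ) (a b : ℕ+) :
    starSum (c :: β) a b = starSum (c :: β) (a + 1) b + recip a ^ c * starSum β a b := by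
  rw [starSum_cons, starSum_cons, ← tsum_ite_eq a (fun j => recip j ^ c * starSum β j b),
    ← ENNReal.tsum_add]
  refine tsum_congr fun j => ?_
  rcases lt_trichotomy a j with h | rfl | h
  · rw [if_pos h.le, if_pos (PNat.add_one_le_iff.2 h), if_neg h.ne', add_zero]
  · simp
  · rw [if_neg (not_le.2 h), if_neg (by rw [PNat.add_one_le_iff]; exact h.not_gt), if_neg h.ne,
      add_zero]

lemma starSum_replicate_self (n c : ℕ) (b : ℕ+) :
    starSum (List.replicate n c) b b = (recip b ^ c) ^ n := by
  induction n with
  | zero => simpa using starSum_nil le_rfl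
  | succ n ih =>
    rw [List.replicate_succ, starSum_cons_eq_add, starSum_of_lt _ (PNat.lt_add_right b 1), ih,
      zero_add, pow_succ']

lemma starSum_replicate (n c : ℕ) {a b : ℕ+} (hab : a < b) :
    starSum (List.replicate n c) a b = ∑ p ∈ Finset.HasAntidiagonal.antidiagonal n,
      (recip a ^ c) ^ p.1 * starSum (List.replicate p.2 c) (a + 1) b := by
  induction n with
  | zero => simp [starSum_nil hab.le, starSum_nil (PNat.add_one_le_iff.2 hab)]
  | succ n ih =>
    rw [Finset.Nat.antidiagonal_succ, Finset.sum_cons, Finset.sum_map, List.replicate_succ,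
      starSum_cons_eq_add, ih, Finset.mul_sum]
    simp [pow_succ', mul_assoc]

lemma tsum_mul_tsum_eq_antidiagonal (u v : ℕ → ℝ≥0∞) :
    (∑' i, u i) * ∑' j, v j = ∑' n, ∑ p ∈ Finset.HasAntidiagonal.antidiagonal n, u p.1 * v p.2 := by
  have h : (∑' i, u i) * ∑' j, v j = ∑' p : ℕ × ℕ, u p.1 * v p.2 := by
    rw [ENNReal.tsum_prod', ← ENNReal.tsum_mul_right]
    exact tsum_congr fun i => ENNReal.tsum_mul_left.symm
  rw [h, ← Finset.HasAntidiagonal.sigmaAntidiagonalEquivProd.tsum_eq, ENNReal.tsum_sigma']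
  refine tsum_congr fun n => ?_
  rw [tsum_fintype]
  exact Finset.sum_coe_sort (Finset.HasAntidiagonal.antidiagonal n) fun p => u p.1 * v p.2

lemma tsum_geometric_recip {t : ℝ} (ht0 : 0 ≤ t) (ht1 : t < 1) (a : ℕ+) :
    ∑' n : ℕ, ENNReal.ofReal t ^ n * (recip a ^ 2) ^ n
      = ENNReal.ofReal (1 - t / ((a.natPred : ℝ) + 1) ^ 2)⁻¹ := by
  have hc : ((a.natPred : ℝ) + 1) = a := by exact_mod_cast congrArg Nat.cast a.natPred_add_one
  have h := one_sub_div_sq_pos ht0 ht1 a.natPred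
  simp_rw [← mul_pow]
  rw [ENNReal.tsum_geometric, ENNReal.ofReal_inv_of_pos h, ENNReal.ofReal_sub _ (by positivity),
    ENNReal.ofReal_one, hc, recip_eq_ofReal, ← ENNReal.ofReal_pow (by positivity),
    ← ENNReal.ofReal_mul ht0, inv_pow, ← div_eq_mul_inv]

lemma tsum_starSum {t : ℝ} (ht0 : 0 ≤ t) (ht1 : t < 1) (d : ℕ) (a b : ℕ+) (hab : (b : ℕ) = a + d) :
    ∑' n : ℕ, ENNReal.ofReal t ^ n * starSum (List.replicate n 2) a b
      = startWeight t a * endWeight t b := by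
  have hq := one_sub_div_sq_pos ht0 ht1 a.natPred
  have hp := partialProd_pos ht0 ht1 a.natPred
  have hsucc := partialProd_succ t a.natPred
  induction d generalizing a with
  | zero =>
    obtain rfl : b = a := PNat.eq (by simpa using hab)
    simp_rw [starSum_replicate_self]
    rw [tsum_geometric_recip ht0 ht1, startWeight, endWeight, ← ENNReal.ofReal_mul hp.le]
    rw [PNat.natPred_add_one] at hsucc
    rw [hsucc]
    congr 1
    rw [mul_inv, mul_inv_cancel_left₀ hp.ne']
  | succ d ih =>
    have hlt : a < b := by
      rw [← PNat.coe_lt_coe]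
      omega
    have hab' : (b : ℕ) = (a + 1 : ℕ+) + d := by
      rw [hab, PNat.add_coe]
      simp only [PNat.one_coe]
      ring
    have ih' := ih (a + 1) hab' (one_sub_div_sq_pos ht0 ht1 _) (partialProd_pos ht0 ht1 _)
      (partialProd_succ t _)
    calc _ = (∑' n : ℕ, ENNReal.ofReal t ^ n * (recip a ^ 2) ^ n)
          * ∑' n : ℕ, ENNReal.ofReal t ^ n * starSum (List.replicate n 2) (a + 1) b := by
          rw [tsum_mul_tsum_eq_antidiagonal]
          refine tsum_congr fun n => ?_
          rw [starSum_replicate n 2 hlt, Finset.mul_sum]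
          refine Finset.sum_congr rfl fun p hp => ?_
          rw [← Finset.HasAntidiagonal.mem_antidiagonal.1 hp, pow_add]
          ring
      _ = _ := by
          rw [ih', tsum_geometric_recip ht0 ht1, startWeight, startWeight, ← mul_assoc,
            ← ENNReal.ofReal_mul (inv_nonneg.2 hq.le)]
          have hn : (a + 1 : ℕ+).natPred = a.natPred + 1 := by
            have := a.pos
            simp only [PNat.natPred, PNat.add_coe, PNat.one_coe]
            omega
          rw [hn, hsucc]
          rw [mul_comm (partialProd t a.natPred), inv_mul_cancel_left₀ hq.ne']

/-! ### The sum `ZB` as a nested sum -/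

/-- The sum `ZB` with extended nonnegative values. -/
noncomputable def ZBENN (a : ℕ) (α β : List ℕ) : ℝ≥0∞ :=
  ∑' k, recip k ^ a * chainSum (starSum β k) α k

lemma ZB_condition_iff {r m : ℕ} (k : ℕ+) (f : Fin r → ℕ+) (g : Fin m → ℕ+) :
    (StrictMono (Matrix.vecCons k f) ∧ Monotone g ∧
      (∀ i : Fin (r + 1), (i : ℕ) = 0 → ∀ j : Fin m, (j : ℕ) = 0 → Matrix.vecCons k f i ≤ g j) ∧
      ∀ j : Fin m, (j : ℕ) = m - 1 → ∀ i : Fin (r + 1), (i : ℕ) = r + 1 - 1 →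
        g j ≤ Matrix.vecCons k f i) ↔
    StrictMono (Matrix.vecCons k f) ∧ Monotone (Matrix.vecCons k g) ∧
      Matrix.vecCons k g (Fin.last m) ≤ Matrix.vecCons k f (Fin.last r) := by
  refine and_congr_right fun hf => ?_
  have hi0 : ∀ i : Fin (r + 1), (i : ℕ) = 0 ↔ i = 0 := fun i => Fin.val_eq_zero_iff
  have hil : ∀ i : Fin (r + 1), (i : ℕ) = r + 1 - 1 ↔ i = Fin.last r := fun i =>
    ⟨fun h => Fin.ext h, fun h => congrArg Fin.val h⟩
  simp only [hi0, hil, forall_eq, Matrix.cons_val_zero]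
  cases m with
  | zero =>
    have h : k ≤ Matrix.vecCons k f (Fin.last r) := hf.monotone (Fin.zero_le _)
    have hg : Monotone g := Subsingleton.monotone (α := Fin 0) _
    have hkg : Monotone (Matrix.vecCons k g) := Subsingleton.monotone (α := Fin 1) _
    simp [h, hg, hkg]
  | succ m =>
    have hj0 : ∀ j : Fin (m + 1), (j : ℕ) = 0 ↔ j = 0 := fun j => Fin.val_eq_zero_iff
    have hjl : ∀ j : Fin (m + 1), (j : ℕ) = m + 1 - 1 ↔ j = Fin.last m := fun j =>
      ⟨fun h => Fin.ext h, fun h => congrArg Fin.val h⟩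
    have hlast : Matrix.vecCons k g (Fin.last (m + 1)) = g (Fin.last m) := rfl
    simp only [hj0, hjl, forall_eq, monotone_vecCons, hlast]
    tauto

lemma ofReal_prod_inv (α : List ℕ) (f : Fin α.length → ℕ+) :
    ENNReal.ofReal (∏ i : Fin α.length, ((f i : ℝ) ^ (α.get i))⁻¹) = monomial α f := by
  rw [ENNReal.ofReal_prod_of_nonneg fun i _ => by positivity, monomial]
  refine Finset.prod_congr rfl fun i _ => ?_
  rw [recip_eq_ofReal, ← ENNReal.ofReal_pow (by positivity), inv_pow]

lemma ZB_cons (a : ℕ) (α β : List ℕ) : ZB (a :: α) β = (ZBENN a α β).toReal := by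
  classical
  have hsum : ∀ {ι : Type} (u : ι → ℝ), (∀ i, 0 ≤ u i) →
      ∑' i, u i = (∑' i, ENNReal.ofReal (u i)).toReal := fun u hu => by
    rw [ENNReal.tsum_toReal_eq fun i => ENNReal.ofReal_ne_top]
    exact tsum_congr fun i => (ENNReal.toReal_ofReal (hu i)).symm
  rw [ZB, hsum _ fun p => by positivity]
  congr 1
  refine (tsum_subtype {p : (Fin (a :: α).length → ℕ+) × (Fin β.length → ℕ+) |
      StrictMono p.1 ∧ Monotone p.2 ∧
      (∀ i : Fin (a :: α).length, (i : ℕ) = 0 →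
        ∀ j : Fin β.length, (j : ℕ) = 0 → p.1 i ≤ p.2 j) ∧
      ∀ j : Fin β.length, (j : ℕ) = β.length - 1 →
        ∀ i : Fin (a :: α).length, (i : ℕ) = (a :: α).length - 1 → p.2 j ≤ p.1 i}
    fun p => ENNReal.ofReal ((∏ i : Fin (a :: α).length, ((p.1 i : ℝ) ^ ((a :: α).get i))⁻¹) *
      ∏ j : Fin β.length, ((p.2 j : ℝ) ^ (β.get j))⁻¹)).trans ?_
  rw [ENNReal.tsum_prod']
  refine (tsum_tuple_succ (r := α.length) _).trans (tsum_congr fun k => ?_)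
  rw [chainSum, ← ENNReal.tsum_mul_left]
  refine tsum_congr fun f => ?_
  have hterm : ∀ g : Fin β.length → ℕ+,
      ENNReal.ofReal ((∏ i : Fin (a :: α).length,
        (((Matrix.vecCons k f : Fin (α.length + 1) → ℕ+) i : ℝ) ^ ((a :: α).get i))⁻¹) *
        ∏ j : Fin β.length, ((g j : ℝ) ^ (β.get j))⁻¹)
      = recip k ^ a * monomial α f * monomial β g := fun g => by
    rw [ENNReal.ofReal_mul (by positivity), ofReal_prod_inv β g, ← monomial_cons]
    congr 1
    exact ofReal_prod_inv (a :: α) (Matrix.vecCons k f)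
  by_cases hf : StrictMono (Matrix.vecCons k f)
  · rw [if_pos hf, starSum, ← mul_assoc, ← ENNReal.tsum_mul_left]
    refine tsum_congr fun g => ?_
    rw [Set.indicator_apply, mul_ite, mul_zero, ← hterm]
    exact if_congr ((ZB_condition_iff k f g).trans (and_iff_right hf)) rfl rfl
  · rw [if_neg hf, mul_zero]
    exact ENNReal.tsum_eq_zero.2 fun g => Set.indicator_of_notMem (fun h => hf h.1) _

lemma tsum_ZBENN {t : ℝ} (ht0 : 0 ≤ t) (ht1 : t < 1) (a : ℕ) (α : List ℕ) :
    ∑' n : ℕ, ENNReal.ofReal t ^ n * ZBENN a α (List.replicate n 2)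
      = ∑' k, recip k ^ a * startWeight t k * chainSum (endWeight t) α k := by
  classical
  simp only [ZBENN, ← ENNReal.tsum_mul_left]
  rw [ENNReal.tsum_comm]
  refine tsum_congr fun k => ?_
  simp only [chainSum, ← ENNReal.tsum_mul_left]
  rw [ENNReal.tsum_comm]
  refine tsum_congr fun f => ?_
  split_ifs with hf
  · have h : k ≤ Matrix.vecCons k f (Fin.last _) := hf.monotone (Fin.zero_le _)
    obtain ⟨d, hd⟩ := Nat.exists_eq_add_of_le (PNat.coe_le_coe _ _ |>.2 h)
    calc _ = ∑' n : ℕ, recip k ^ a * monomial α f * (ENNReal.ofReal t ^ n *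
          starSum (List.replicate n 2) k (Matrix.vecCons k f (Fin.last _))) :=
          tsum_congr fun n => by ring
      _ = _ := by
          rw [ENNReal.tsum_mul_left, tsum_starSum ht0 ht1 d k _ hd]
          ring
  · simp

/-! ### The word of an index -/

/-- The word of an index, each entry `a` contributing `false` followed by `a - 1` times `true`. -/
def indexWord (α : List ℕ) : List Bool :=
  α.flatMap fun a => false :: List.replicate (a - 1) true

/-- The word of the block `({1}^{p.1}, p.2 + 2)` of an index. -/
def blockWord (p : ℕ × ℕ) : List Bool :=
  List.replicate (p.1 + 1) false ++ List.replicate (p.2 + 1) true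

lemma wordAdj_append (V W : List Bool) (φ : ℕ+ → ℝ≥0∞) :
    wordAdj (V ++ W) φ = wordAdj V (wordAdj W φ) :=
  List.foldr_append

lemma wordAdj_replicate_true (c : ℕ) (φ : ℕ+ → ℝ≥0∞) (m : ℕ+) :
    wordAdj (List.replicate c true) φ m = recip m ^ c * φ m := by
  induction c with
  | zero => simp [wordAdj]
  | succ c ih =>
    change recip m * wordAdj (List.replicate c true) φ m = _
    rw [ih, pow_succ', mul_assoc]

lemma chainSum_eq_wordAdj (φ : ℕ+ → ℝ≥0∞) (α : List ℕ) (hα : ∀ a ∈ α, 1 ≤ a) (k : ℕ+) :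
    chainSum φ α k = wordAdj (indexWord α) φ k := by
  induction α generalizing k with
  | nil => exact chainSum_nil φ k
  | cons a α ih =>
    obtain ⟨c, rfl⟩ : ∃ c, a = c + 1 := ⟨a - 1, by have := hα a (by simp); omega⟩
    rw [chainSum_cons, indexWord, List.flatMap_cons, List.cons_append]
    change _ = ∑' m, if k < m then
      recip m * wordAdj (List.replicate c true ++ indexWord α) φ m else 0
    refine tsum_congr fun m => ?_
    rw [wordAdj_append, wordAdj_replicate_true, ih fun b hb => hα b (by simp [hb]), pow_succ',
      mul_assoc]

lemma tsum_ZBENN_eq_wordSum {t : ℝ} (ht0 : 0 ≤ t) (ht1 : t < 1) {a : ℕ} {α : List ℕ}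
    (hα : ∀ b ∈ a :: α, 1 ≤ b) {W : List Bool} (hW : indexWord (a :: α) = false :: W ++ [true]) :
    ∑' n : ℕ, ENNReal.ofReal t ^ n * ZBENN a α (List.replicate n 2) = wordSum t W := by
  obtain ⟨c, rfl⟩ : ∃ c, a = c + 1 := ⟨a - 1, by have := hα a (by simp); omega⟩
  have hW' : List.replicate c true ++ indexWord α = W ++ [true] := by
    simpa [indexWord] using hW
  rw [tsum_ZBENN ht0 ht1, wordSum]
  refine tsum_congr fun k => ?_
  have h : wordAdj W (fun n => recip n * endWeight t n) k
      = recip k ^ c * chainSum (endWeight t) α k := by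
    rw [chainSum_eq_wordAdj _ _ fun b hb => hα b (by simp [hb]), ← wordAdj_replicate_true,
      ← wordAdj_append, hW', wordAdj_append]
    rfl
  rw [h]
  ring

lemma indexWord_flatten (L : List (ℕ × ℕ)) :
    indexWord (L.map fun p => List.replicate p.1 1 ++ [p.2 + 2]).flatten
      = L.flatMap blockWord := by
  have hrep : ∀ c : ℕ, indexWord (List.replicate c 1) = List.replicate c false := by
    intro c
    induction c with
    | zero => rfl
    | succ c ih => simpa [indexWord, List.replicate_succ] using ih
  induction L with
  | nil => rfl
  | cons p L ih =>
    have happ : ∀ u v : List ℕ, indexWord (u ++ v) = indexWord u ++ indexWord v := fun u v =>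
      List.flatMap_append
    rw [List.map_cons, List.flatten_cons, List.flatMap_cons, happ, happ, ih, hrep, blockWord]
    simp [indexWord, List.replicate_succ']

lemma one_le_of_mem_flatten {L : List (ℕ × ℕ)} {a : ℕ}
    (ha : a ∈ (L.map fun p => List.replicate p.1 1 ++ [p.2 + 2]).flatten) : 1 ≤ a := by
  simp only [List.mem_flatten, List.mem_map] at ha
  obtain ⟨_, ⟨p, _, rfl⟩, h⟩ := ha
  simp only [List.mem_append, List.mem_replicate, List.mem_singleton] at h
  omega

lemma dualWord_append (V W : List Bool) : dualWord (V ++ W) = dualWord W ++ dualWord V := by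
  simp [dualWord]

lemma dualWord_blockWord (p : ℕ × ℕ) : dualWord (blockWord p) = blockWord p.swap := by
  simp [dualWord, blockWord]

lemma dualWord_flatMap (L : List (ℕ × ℕ)) :
    dualWord (L.flatMap blockWord) = (L.reverse.map Prod.swap).flatMap blockWord := by
  induction L with
  | nil => rfl
  | cons p L ih =>
    rw [List.flatMap_cons, dualWord_append, ih, dualWord_blockWord]
    simp

lemma exists_flatMap_blockWord (p : ℕ × ℕ) (L : List (ℕ × ℕ)) :
    ∃ W, (p :: L).flatMap blockWord = false :: W ++ [true] := by
  induction L generalizing p with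
  | nil =>
    refine ⟨List.replicate p.1 false ++ List.replicate p.2 true, ?_⟩
    simp [blockWord, List.replicate_succ (n := p.1), List.replicate_succ' (n := p.2)]
  | cons q L ih =>
    obtain ⟨W, hW⟩ := ih q
    refine ⟨List.replicate p.1 false ++ List.replicate (p.2 + 1) true ++ false :: W, ?_⟩
    rw [List.flatMap_cons, hW]
    simp [blockWord, List.replicate_succ (n := p.1)]

/-! ### Comparison of coefficients -/

lemma coeff_zero_le {A B : ℕ → ℝ≥0∞}
    (h : ∀ t : ℝ, 0 < t → t < 1 →
      ∑' n, ENNReal.ofReal t ^ n * A n ≤ ∑' n, ENNReal.ofReal t ^ n * B n)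
    (hfin : ∑' n, ENNReal.ofReal (1 / 2) ^ n * B n ≠ ∞) : A 0 ≤ B 0 := by
  set S := ∑' n, ENNReal.ofReal (1 / 2) ^ n * B n with hS
  have hlim : Filter.Tendsto (fun s : ℝ => B 0 + ENNReal.ofReal s * S)
      (nhdsWithin 0 (Set.Ioi 0)) (nhds (B 0)) := by
    have h1 : Filter.Tendsto (fun s : ℝ => ENNReal.ofReal s) (nhdsWithin 0 (Set.Ioi 0))
        (nhds (ENNReal.ofReal 0)) :=
      ENNReal.tendsto_ofReal (Filter.tendsto_id.mono_left nhdsWithin_le_nhds)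
    have h2 := (ENNReal.Tendsto.mul_const h1 (Or.inr hfin)).const_add (B 0)
    simpa using h2
  refine ge_of_tendsto hlim ?_
  filter_upwards [Ioo_mem_nhdsGT (zero_lt_one' ℝ)] with s hs
  have hhalf : ENNReal.ofReal (s * (1 / 2)) = ENNReal.ofReal s * ENNReal.ofReal (1 / 2) :=
    ENNReal.ofReal_mul hs.1.le
  have hs1 : ENNReal.ofReal s ≤ 1 := ENNReal.ofReal_le_one.2 hs.2.le
  calc A 0 = ENNReal.ofReal (s * (1 / 2)) ^ 0 * A 0 := by simp
    _ ≤ ∑' n, ENNReal.ofReal (s * (1 / 2)) ^ n * A n :=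
        ENNReal.le_tsum (f := fun n => ENNReal.ofReal (s * (1 / 2)) ^ n * A n) 0
    _ ≤ ∑' n, ENNReal.ofReal (s * (1 / 2)) ^ n * B n :=
        h _ (by have := hs.1; positivity) (by have := hs.2; linarith)
    _ = B 0 + ∑' n, ENNReal.ofReal (s * (1 / 2)) ^ (n + 1) * B (n + 1) := by
        rw [tsum_eq_zero_add' ENNReal.summable]
        simp
    _ ≤ B 0 + ∑' n, ENNReal.ofReal s * (ENNReal.ofReal (1 / 2) ^ (n + 1) * B (n + 1)) := by
        gcongr B 0 + ?_
        refine ENNReal.tsum_le_tsum fun n => ?_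
        rw [hhalf, mul_pow, mul_assoc]
        gcongr
        exact pow_le_of_le_one zero_le hs1 (Nat.succ_ne_zero n)
    _ ≤ B 0 + ENNReal.ofReal s * S := by
        rw [ENNReal.tsum_mul_left]
        gcongr
        rw [hS, tsum_eq_zero_add' (f := fun n => ENNReal.ofReal (1 / 2) ^ n * B n)
          ENNReal.summable]
        exact le_add_self

lemma coeff_eq {A B : ℕ → ℝ≥0∞}
    (h : ∀ t : ℝ, 0 < t → t < 1 →
      ∑' n, ENNReal.ofReal t ^ n * A n = ∑' n, ENNReal.ofReal t ^ n * B n)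
    (hfin : ∀ t : ℝ, 0 < t → t < 1 → ∑' n, ENNReal.ofReal t ^ n * B n ≠ ∞) (n : ℕ) :
    A n = B n := by
  have hB := hfin (1 / 2) (by norm_num) (by norm_num)
  have hA := hB
  rw [← h _ (by norm_num) (by norm_num)] at hA
  have h0 : A 0 = B 0 := le_antisymm (coeff_zero_le (fun t h1 h2 => (h t h1 h2).le) hB)
    (coeff_zero_le (fun t h1 h2 => (h t h1 h2).ge) hA)
  induction n generalizing A B with
  | zero => exact h0
  | succ n ih =>
    have hsplit : ∀ (D : ℕ → ℝ≥0∞) (t : ℝ), ∑' n, ENNReal.ofReal t ^ n * D n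
        = D 0 + ENNReal.ofReal t * ∑' n, ENNReal.ofReal t ^ n * D (n + 1) := fun D t => by
      rw [tsum_eq_zero_add' ENNReal.summable, ← ENNReal.tsum_mul_left]
      simp [pow_succ', mul_assoc]
    have hpos : ∀ t : ℝ, 0 < t → ENNReal.ofReal t ≠ 0 := fun t ht => by simpa using ht
    have hB0 : B 0 ≠ ∞ := fun hB0 => hB (by rw [hsplit, hB0, top_add])
    have h' : ∀ t : ℝ, 0 < t → t < 1 → ∑' n, ENNReal.ofReal t ^ n * A (n + 1)
        = ∑' n, ENNReal.ofReal t ^ n * B (n + 1) := fun t h1 h2 => by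
      have := h t h1 h2
      rwa [hsplit A, hsplit B, h0, ENNReal.add_right_inj hB0,
        ENNReal.mul_right_inj (hpos t h1) ENNReal.ofReal_ne_top] at this
    have hfin' : ∀ t : ℝ, 0 < t → t < 1 → ∑' n, ENNReal.ofReal t ^ n * B (n + 1) ≠ ∞ :=
      fun t h1 h2 htop => hfin t h1 h2 (by
        rw [hsplit, htop, ENNReal.mul_top (hpos t h1), add_top])
    have hB' := hfin' (1 / 2) (by norm_num) (by norm_num)
    have hA' := hB'
    rw [← h' _ (by norm_num) (by norm_num)] at hA'
    exact ih (A := fun n => A (n + 1)) (B := fun n => B (n + 1)) h' hfin' hB' hA'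
      (le_antisymm (coeff_zero_le (fun t h1 h2 => (h' t h1 h2).le) hB')
        (coeff_zero_le (fun t h1 h2 => (h' t h1 h2).ge) hA'))

lemma ZB_eq_of_indexWord {α β : List ℕ} (hα : ∀ a ∈ α, 1 ≤ a) (hβ : ∀ b ∈ β, 1 ≤ b)
    {W : List Bool} (hαW : indexWord α = false :: W ++ [true])
    (hβW : indexWord β = false :: dualWord W ++ [true]) (n : ℕ) :
    ZB α (List.replicate n 2) = ZB β (List.replicate n 2) := by
  cases α with
  | nil => simp [indexWord] at hαW
  | cons a α =>
    cases β with
    | nil => simp [indexWord] at hβW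
    | cons b β =>
      rw [ZB_cons, ZB_cons]
      congr 1
      refine coeff_eq (A := fun n => ZBENN a α (List.replicate n 2))
        (B := fun n => ZBENN b β (List.replicate n 2)) (fun t h1 h2 => ?_) (fun t h1 h2 => ?_) n
      · rw [tsum_ZBENN_eq_wordSum h1.le h2 hα hαW, tsum_ZBENN_eq_wordSum h1.le h2 hβ hβW,
          wordSum_dualWord h1.le h2]
      · rw [tsum_ZBENN_eq_wordSum h1.le h2 hβ hβW]
        exact wordSum_ne_top h1.le h2 _

end ZBDuality

/-- Duality theorem for `Z_B` (Theorem 1.3):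
if `β` is the dual index of the admissible index `α`, then
`Z_B(α; {2}ⁿ) = Z_B(β; {2}ⁿ)` for every nonnegative integer `n`. -/
theorem stmt_5 (L : List (ℕ × ℕ)) (n : ℕ)
    (α β : List ℕ)
    (hαdef : α = (L.map (fun p => List.replicate p.1 1 ++ [p.2 + 2])).flatten)
    (hβdef : β = (L.reverse.map (fun p => List.replicate p.2 1 ++ [p.1 + 2])).flatten) :
    ZB α (List.replicate n 2) = ZB β (List.replicate n 2) := by
  cases L with
  | nil => subst hαdef hβdef; rfl
  | cons p L =>
    obtain ⟨W, hW⟩ := ZBDuality.exists_flatMap_blockWord p L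
    have hβswap : β = (((p :: L).reverse.map Prod.swap).map
        fun q => List.replicate q.1 1 ++ [q.2 + 2]).flatten := by
      rw [hβdef, List.map_map]
      rfl
    refine ZBDuality.ZB_eq_of_indexWord (W := W) ?_ ?_ ?_ ?_ n
    · rw [hαdef]
      exact fun a => ZBDuality.one_le_of_mem_flatten
    · rw [hβswap]
      exact fun a => ZBDuality.one_le_of_mem_flatten
    · rw [hαdef, ZBDuality.indexWord_flatten, hW]
    · rw [hβswap, ZBDuality.indexWord_flatten, ← ZBDuality.dualWord_flatMap, hW]
      simp [ZBDuality.dualWord]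
end

section
/- For any positive integers p and q, one has ζ⋆({2}^p, 1, {2}^q) = 2 Σ_{k=1}^{p+q} [ C(2k, 2q) − (1 − 2^{-2k}) C(2k, 2p−1) ] · ζ⋆({2}^{p+q−k}) · ζ(2k+1), where C(n,r) denotes the binomial coefficient and ζ(s) is the Riemann zeta value. -/
open scoped BigOperators

namespace MzvStar

open Finset Filter Topology

/-- The kernel `n!² / ((n - k)! (n + k)!)`, which vanishes for `n < k`. -/
noncomputable def kernel (n k : ℕ) : ℝ :=
  ∏ i ∈ range k, ((n : ℝ) - i) / (n + i + 1)

lemma kernel_zero_right (n : ℕ) : kernel n 0 = 1 := by simp [kernel]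

lemma kernel_succ_right (n k : ℕ) :
    kernel n (k + 1) = kernel n k * (((n : ℝ) - k) / (n + k + 1)) := by
  rw [kernel, prod_range_succ, kernel]

lemma kernel_eq_zero {n k : ℕ} (h : n < k) : kernel n k = 0 :=
  prod_eq_zero (mem_range.2 h) (by simp)

lemma kernel_nonneg (n k : ℕ) : 0 ≤ kernel n k := by
  rcases lt_or_ge n k with h | h
  · rw [kernel_eq_zero h]
  · refine prod_nonneg fun i hi => div_nonneg ?_ (by positivity)
    have : (i : ℝ) ≤ n := by exact_mod_cast (mem_range.1 hi).le.trans h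
    linarith

lemma kernel_succ_left (n k : ℕ) :
    kernel (n + 1) k * (((n : ℝ) + 1 - k) * (n + 1 + k)) = ((n : ℝ) + 1) ^ 2 * kernel n k := by
  induction k with
  | zero => simp [kernel_zero_right]; ring
  | succ k ih =>
    rw [kernel_succ_right, kernel_succ_right]
    push_cast
    have h1 : (n : ℝ) + 1 + k + 1 ≠ 0 := by positivity
    have h2 : (n : ℝ) + k + 1 ≠ 0 := by positivity
    calc _ = kernel (n + 1) k * (((n : ℝ) + 1 - k) * (n + 1 + k)) * ((n - k) / (n + k + 1)) := by
            field_simp; ring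
      _ = _ := by rw [ih]; ring

lemma tendsto_kernel (k : ℕ) : Tendsto (fun n => kernel n k) atTop (𝓝 1) := by
  have h (i : ℕ) : Tendsto (fun n : ℕ => ((n : ℝ) - i) / (n + i + 1)) atTop (𝓝 1) := by
    have h0 : Tendsto (fun n : ℕ => (n : ℝ) + i + 1) atTop atTop :=
      tendsto_atTop_add_const_right _ _
        (tendsto_atTop_add_const_right _ _ tendsto_natCast_atTop_atTop)
    have h1 := (tendsto_const_nhds (x := (2 * i + 1 : ℝ))).div_atTop h0
    have h2 := (tendsto_const_nhds (x := (1 : ℝ))).sub h1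
    rw [sub_zero] at h2
    refine h2.congr fun n => ?_
    have : (n : ℝ) + i + 1 ≠ 0 := by positivity
    field_simp
    ring
  simpa [kernel] using tendsto_finsetProd (range k) fun i _ => h i

lemma sum_kernel_div_sq (m : ℕ) {k : ℕ} (hk : k ≠ 0) :
    ∑ n ∈ range (m + 1), kernel n k / (n : ℝ) ^ 2 = kernel m k / (k : ℝ) ^ 2 := by
  induction m with
  | zero => simp [kernel_eq_zero (Nat.pos_of_ne_zero hk)]
  | succ m ih =>
    rw [sum_range_succ, ih]
    have h := kernel_succ_left m k
    have hk' : (k : ℝ) ≠ 0 := by exact_mod_cast hk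
    have hm : (m : ℝ) + 1 ≠ 0 := by positivity
    push_cast
    field_simp
    linear_combination -h

lemma sum_kernel_div_sub (m : ℕ) {k : ℕ} (hk : k ≠ 0) :
    ∑ n ∈ range (m + 1), kernel n k / (n : ℝ) =
      ∑ n ∈ range (m + 1), kernel n (k + 1) / (n : ℝ) +
        (kernel m k / k + kernel m (k + 1) / ((k + 1 : ℕ) : ℝ)) := by
  induction m with
  | zero => simp [kernel_eq_zero (Nat.pos_of_ne_zero hk), kernel_eq_zero (Nat.succ_pos k)]
  | succ m ih =>
    rw [sum_range_succ _ (m + 1), ih, sum_range_succ _ (m + 1)]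
    have h1 := kernel_succ_left m k
    have h2 := kernel_succ_left m (k + 1)
    have h3 := kernel_succ_right (m + 1) k
    have hk' : (k : ℝ) ≠ 0 := by exact_mod_cast hk
    have hk1 : (k : ℝ) + 1 ≠ 0 := by positivity
    have hm : (m : ℝ) + 1 ≠ 0 := by positivity
    have hmk : (m : ℝ) + 1 + k + 1 ≠ 0 := by positivity
    push_cast at *
    have e1 : kernel m k =
        kernel (m + 1) k * (((m : ℝ) + 1 - k) * (m + 1 + k)) / ((m : ℝ) + 1) ^ 2 := by
      rw [h1]; field_simp
    have e2 : kernel m (k + 1) =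
        kernel (m + 1) (k + 1) * (((m : ℝ) + 1 - (k + 1)) * (m + 1 + (k + 1))) /
          ((m : ℝ) + 1) ^ 2 := by
      rw [h2]; field_simp
    rw [e1, e2, h3]
    field_simp
    ring

/-- The weight `1` on the diagonal, `2` above it and `0` below it. -/
noncomputable def weight (k j : ℕ) : ℝ := if j < k then 0 else if j = k then 1 else 2

lemma weight_nonneg (k j : ℕ) : 0 ≤ weight k j := by
  unfold weight; split_ifs <;> norm_num

lemma weight_le_two (k j : ℕ) : weight k j ≤ 2 := by
  unfold weight; split_ifs <;> norm_num

lemma weight_sub (k j : ℕ) :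
    weight k j = weight (k + 1) j + ((if j = k then 1 else 0) + (if j = k + 1 then 1 else 0)) := by
  unfold weight
  split_ifs <;> first | omega | norm_num

lemma sum_kernel_div (m : ℕ) {k : ℕ} (hk : k ≠ 0) :
    ∑ n ∈ range (m + 1), kernel n k / (n : ℝ) =
      ∑ j ∈ range (m + 1), weight k j * (kernel m j / j) := by
  obtain h | h := lt_or_ge m k
  · rw [sum_eq_zero, sum_eq_zero]
    · intro j hj
      rw [mem_range] at hj
      simp [weight, show j < k by omega]
    · intro n hn
      rw [mem_range] at hn
      simp [kernel_eq_zero (show n < k by omega)]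
  · induction h using Nat.decreasingInduction with
    | of_succ k' hk' ih =>
      rw [sum_kernel_div_sub m hk, ih (Nat.succ_ne_zero _)]
      simp_rw [weight_sub k', add_mul, sum_add_distrib]
      congr 2
      · simp [show k' < m + 1 by omega]
      · simp only [ite_mul, one_mul, zero_mul, sum_ite_eq', mem_range]
        rw [if_pos (by omega)]
    | self =>
      have h0 : ∀ n ∈ range m, kernel n m / (n : ℝ) = 0 := fun n hn => by
        simp [kernel_eq_zero (mem_range.1 hn)]
      have h1 : ∀ j ∈ range m, weight m j * (kernel m j / j) = 0 := fun j hj => by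
        simp [weight, mem_range.1 hj]
      rw [sum_range_succ, sum_range_succ, sum_eq_zero h0, sum_eq_zero h1]
      simp [weight]

lemma sum_alternating_kernel {n : ℕ} (hn : n ≠ 0) (K : ℕ) :
    ∑ k ∈ range K, (-1 : ℝ) ^ k * kernel n (k + 1) =
      1 / 2 - (-1) ^ K * (kernel n (K + 1) * ((n + K + 1) / (2 * n))) := by
  have hn' : (n : ℝ) ≠ 0 := by exact_mod_cast hn
  induction K with
  | zero =>
    have : (n : ℝ) + 1 ≠ 0 := by positivity
    simp [kernel_succ_right, kernel_zero_right]
    field_simp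
    simp
  | succ K ih =>
    have h1 : (n : ℝ) + (K + 1) + 1 ≠ 0 := by positivity
    rw [sum_range_succ, ih, kernel_succ_right n (K + 1)]
    push_cast
    field_simp
    ring

/-- The finite star sum `∑_{1 ≤ k₁ ≤ ⋯ ≤ k_p ≤ n} (k₁ ⋯ k_p)⁻²`. -/
noncomputable def finiteStar : ℕ → ℕ → ℝ
  | 0, _ => 1
  | p + 1, n => ∑ k ∈ range (n + 1), finiteStar p k / (k : ℝ) ^ 2

lemma finiteStar_nonneg (p n : ℕ) : 0 ≤ finiteStar p n := by
  induction p generalizing n with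
  | zero => simp [finiteStar]
  | succ p ih => exact sum_nonneg fun k _ => div_nonneg (ih k) (by positivity)

lemma finiteStar_eq (p : ℕ) {n : ℕ} (hn : n ≠ 0) :
    finiteStar p n =
      2 * ∑ k ∈ range n, (-1 : ℝ) ^ k / ((k + 1 : ℕ) : ℝ) ^ (2 * p) * kernel n (k + 1) := by
  induction p generalizing n with
  | zero =>
    have := sum_alternating_kernel hn n
    rw [kernel_eq_zero (Nat.lt_succ_self n)] at this
    simp [finiteStar, this]
  | succ p ih =>
    have h (m : ℕ) (hm : m ∈ range (n + 1)) : finiteStar p m / (m : ℝ) ^ 2 =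
        2 * ∑ k ∈ range n, (-1 : ℝ) ^ k / ((k + 1 : ℕ) : ℝ) ^ (2 * p) *
          (kernel m (k + 1) / (m : ℝ) ^ 2) := by
      rcases eq_or_ne m 0 with rfl | hm0
      · simp
      · rw [ih hm0, mul_div_assoc, sum_div]
        congr 1
        simp_rw [mul_div_assoc]
        refine sum_subset (range_subset_range.2 (by rw [mem_range] at hm; omega)) fun k _ hk => ?_
        rw [kernel_eq_zero (by rw [mem_range] at hk; omega)]
        simp
    rw [finiteStar, sum_congr rfl h, ← mul_sum, sum_comm]
    congr 1
    refine sum_congr rfl fun k _ => ?_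
    rw [← mul_sum, sum_kernel_div_sq n k.add_one_ne_zero, mul_add 2 p 1, pow_add]
    have : ((k + 1 : ℕ) : ℝ) ≠ 0 := by positivity
    field_simp

/-- The summation operator `f ↦ (n ↦ ∑_{k ≥ n} k^{-a} f(k))`. -/
noncomputable def tailSum (a : ℕ) (f : ℕ → ENNReal) (n : ℕ) : ENNReal :=
  ∑' k : ℕ, if n ≤ k then ENNReal.ofReal (((k : ℝ) ^ a)⁻¹) * f k else 0

/-- The star sum `∑_{n ≤ k₁ ≤ ⋯ ≤ k_r} k₁^{-α₁} ⋯ k_r^{-α_r}` truncated from below. -/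
noncomputable def tailStar : List ℕ → ℕ → ENNReal
  | [] => fun _ => 1
  | a :: l => tailSum a (tailStar l)

lemma tsum_mul_tailSum (a : ℕ) (h f : ℕ → ENNReal) :
    ∑' n, h n * tailSum a f n =
      ∑' k : ℕ, (∑ n ∈ range (k + 1), h n) * (ENNReal.ofReal (((k : ℝ) ^ a)⁻¹) * f k) := by
  simp_rw [tailSum, ← ENNReal.tsum_mul_left]
  rw [ENNReal.tsum_comm]
  refine tsum_congr fun k => ?_
  rw [sum_mul, tsum_eq_sum (s := range (k + 1))]
  · refine sum_congr rfl fun n hn => ?_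
    rw [if_pos (by rw [mem_range] at hn; omega)]
  · intro n hn
    rw [if_neg (by rw [mem_range] at hn; omega), mul_zero]

lemma monotone_cons_iff {r : ℕ} (x : ℕ) (a : ℕ+) (f : Fin r → ℕ+) :
    (Monotone (Fin.cons a f : Fin (r + 1) → ℕ+) ∧
        ∀ i, x ≤ ((Fin.cons a f : Fin (r + 1) → ℕ+) i : ℕ)) ↔
      x ≤ (a : ℕ) ∧ Monotone f ∧ ∀ i, (a : ℕ) ≤ f i := by
  constructor
  · rintro ⟨hm, hx⟩
    refine ⟨hx 0, fun i j hij => ?_, fun i => ?_⟩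
    · simpa using hm (Fin.succ_le_succ_iff.2 hij)
    · simpa using hm (Fin.zero_le i.succ)
  · rintro ⟨hx, hm, ha⟩
    refine ⟨fun i j hij => ?_, fun i => ?_⟩
    · induction i using Fin.cases with
      | zero =>
        induction j using Fin.cases with
        | zero => exact le_rfl
        | succ j => simpa using ha j
      | succ i =>
        induction j using Fin.cases with
        | zero => exact absurd hij (by simp)
        | succ j => simpa using hm (Fin.succ_le_succ_iff.1 hij)
    · induction i using Fin.cases with
      | zero => simpa using hx
      | succ i => simpa using hx.trans (ha i)

open Classical in
lemma tsum_monotone_eq_tailStar (l : List ℕ) {x : ℕ} (hx : x ≠ 0) :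
    ∑' f : Fin l.length → ℕ+, (if Monotone f ∧ ∀ i, x ≤ (f i : ℕ) then
      ∏ i, ENNReal.ofReal (((f i : ℝ) ^ l.get i)⁻¹) else 0) = tailStar l x := by
  induction l generalizing x with
  | nil =>
    have : IsEmpty (Fin ([] : List ℕ).length) := inferInstanceAs (IsEmpty (Fin 0))
    have : Unique (Fin ([] : List ℕ).length → ℕ+) := Pi.uniqueOfIsEmpty _
    rw [tsum_fintype, Fintype.sum_unique, if_pos]
    · rw [tailStar]; exact prod_eq_one fun i => i.elim0
    · exact ⟨fun i => i.elim0, fun i => i.elim0⟩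
  | cons a l ih =>
    rw [tailStar, tailSum]
    refine ((Fin.consEquiv fun _ : Fin (l.length + 1) => ℕ+).tsum_eq _).symm.trans ?_
    rw [ENNReal.tsum_prod']
    have hsupp : Function.support (fun k : ℕ => if x ≤ k then
        ENNReal.ofReal (((k : ℝ) ^ a)⁻¹) * tailStar l k else 0) ⊆
          Set.range ((↑) : ℕ+ → ℕ) := by
      intro k hk
      have : x ≤ k := by
        by_contra h
        simp [h] at hk
      exact ⟨⟨k, by omega⟩, rfl⟩
    rw [← PNat.coe_injective.tsum_eq hsupp]
    refine tsum_congr fun k => ?_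
    rw [← ih k.ne_zero, ← ENNReal.tsum_mul_left]
    have hcond (f : Fin l.length → ℕ+) := monotone_cons_iff x k f
    by_cases hk : x ≤ (k : ℕ)
    · rw [if_pos hk]
      refine tsum_congr fun f => ?_
      have h1 : (Monotone (Fin.cons k f : Fin (l.length + 1) → ℕ+) ∧
        ∀ i, x ≤ ((Fin.cons k f : Fin (l.length + 1) → ℕ+) i : ℕ)) ↔
          (Monotone f ∧ ∀ i, (k : ℕ) ≤ f i) := by
        rw [hcond]; exact and_iff_right hk
      by_cases hf : Monotone f ∧ ∀ i, (k : ℕ) ≤ f i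
      · rw [if_pos hf]
        refine (if_pos (h1.2 hf)).trans ?_
        exact Fin.prod_univ_succ _
      · rw [if_neg hf, mul_zero]
        exact if_neg (fun h => hf (h1.1 h))
    · rw [if_neg hk]
      refine ENNReal.tsum_eq_zero.2 fun f => if_neg fun h => hk ((hcond f).1 h).1

lemma mzvStar_eq_toReal (l : List ℕ) : mzvStar l = (tailStar l 1).toReal := by
  classical
  rw [← tsum_monotone_eq_tailStar l one_ne_zero, mzvStar]
  have h (f : Fin l.length → ℕ+) : (Monotone f ∧ ∀ i, 1 ≤ (f i : ℕ)) ↔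
      f ∈ {f : Fin l.length → ℕ+ | Monotone f} :=
    and_iff_left fun i => (f i).pos
  simp_rw [h]
  have := tsum_subtype {f : Fin l.length → ℕ+ | Monotone f}
    fun f => ∏ i, ENNReal.ofReal (((f i : ℝ) ^ l.get i)⁻¹)
  simp only [Set.indicator_apply] at this
  rw [← this, ENNReal.tsum_toReal_eq fun f => ENNReal.prod_ne_top fun i _ => ENNReal.ofReal_ne_top]
  refine tsum_congr fun f => ?_
  rw [ENNReal.toReal_prod]
  exact prod_congr rfl fun i _ => (ENNReal.toReal_ofReal (by positivity)).symm

lemma mzv_singleton (s : ℕ) : mzv [s] = ∑' n : ℕ, (((n + 1 : ℕ) : ℝ) ^ s)⁻¹ := by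
  have hmono (n : ℕ+) : StrictMono (fun _ : Fin [s].length => n) := fun i j hij => by
    have : i = j := Subsingleton.elim (α := Fin 1) i j
    exact absurd hij (by simp [this])
  let e : ℕ+ ≃ {f : Fin [s].length → ℕ+ // StrictMono f} :=
    { toFun := fun n => ⟨fun _ => n, hmono n⟩
      invFun := fun f => f.1 ⟨0, Nat.one_pos⟩
      left_inv := fun n => rfl
      right_inv := fun f => Subtype.ext <| funext fun i =>
        congrArg f.1 (Subsingleton.elim (α := Fin 1) _ i) }
  rw [mzv, ← e.tsum_eq, ← tsum_pnat_eq_tsum_succ (f := fun n : ℕ => ((n : ℝ) ^ s)⁻¹)]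
  refine tsum_congr fun n => ?_
  exact Fin.prod_univ_one _

lemma tailStar_replicate_append (p a : ℕ) (ha : a ≠ 0) (l : List ℕ) :
    tailStar (List.replicate p 2 ++ a :: l) 1 =
      ∑' n : ℕ, ENNReal.ofReal (finiteStar p n) *
        (ENNReal.ofReal (((n : ℝ) ^ a)⁻¹) * tailStar l n) := by
  induction p generalizing a l with
  | zero =>
    rw [List.replicate_zero, List.nil_append, tailStar, tailSum]
    refine tsum_congr fun n => ?_
    rcases eq_or_ne n 0 with rfl | hn
    · simp [ha]
    · simp [finiteStar, Nat.one_le_iff_ne_zero, hn]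
  | succ p ih =>
    have : List.replicate (p + 1) 2 ++ a :: l = List.replicate p 2 ++ 2 :: (a :: l) := by
      rw [List.replicate_succ']; simp
    rw [this, ih 2 two_ne_zero]
    simp_rw [← mul_assoc (ENNReal.ofReal (finiteStar p _)),
      ← ENNReal.ofReal_mul (finiteStar_nonneg _ _)]
    rw [tailStar, tsum_mul_tailSum]
    refine tsum_congr fun k => ?_
    rw [finiteStar, ENNReal.ofReal_sum_of_nonneg]
    · rfl
    · exact fun i _ => div_nonneg (finiteStar_nonneg _ _) (by positivity)

lemma summable_inv_succ_pow {s : ℕ} (hs : 1 < s) :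
    Summable fun n : ℕ => (((n + 1 : ℕ) : ℝ) ^ s)⁻¹ :=
  (summable_nat_add_iff (f := fun n : ℕ => ((n : ℝ) ^ s)⁻¹) 1).2
    (Real.summable_nat_pow_inv.2 hs)

lemma tailStar_replicate_ne_top (q n : ℕ) : tailStar (List.replicate q 2) n ≠ ⊤ := by
  set C : ENNReal := ∑' k : ℕ, ENNReal.ofReal (((k : ℝ) ^ 2)⁻¹) with hC
  have hC' : C ≠ ⊤ := (Real.summable_nat_pow_inv.2 one_lt_two).tsum_ofReal_ne_top
  have h : tailStar (List.replicate q 2) n ≤ C ^ q := by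
    induction q generalizing n with
    | zero => simp [tailStar]
    | succ q ih =>
      rw [List.replicate_succ, tailStar, tailSum, pow_succ', hC, ← ENNReal.tsum_mul_right]
      refine ENNReal.tsum_le_tsum fun k => ?_
      split_ifs
      · gcongr
        exact ih k
      · exact zero_le
  exact ne_top_of_le_ne_top (ENNReal.pow_ne_top hC') h

lemma tsum_kernel_div_sq_mul_tailStar (q : ℕ) {k : ℕ} (hk : k ≠ 0) :
    ∑' n : ℕ, ENNReal.ofReal (kernel n k / (n : ℝ) ^ 2) * tailStar (List.replicate q 2) n =
      ENNReal.ofReal (((k : ℝ) ^ (2 * q + 2))⁻¹) := by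
  have hnonneg (n : ℕ) : 0 ≤ kernel n k / (n : ℝ) ^ 2 :=
    div_nonneg (kernel_nonneg _ _) (by positivity)
  induction q with
  | zero =>
    have h : HasSum (fun n : ℕ => kernel n k / (n : ℝ) ^ 2) (((k : ℝ) ^ 2)⁻¹) := by
      rw [hasSum_iff_tendsto_nat_of_nonneg hnonneg, ← tendsto_add_atTop_iff_nat 1]
      simp_rw [sum_kernel_div_sq _ hk]
      simpa using (tendsto_kernel k).div_const ((k : ℝ) ^ 2)
    simp only [List.replicate_zero, tailStar, mul_one, mul_zero, zero_add]
    rw [← ENNReal.ofReal_tsum_of_nonneg hnonneg h.summable, h.tsum_eq]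
  | succ q ih =>
    rw [List.replicate_succ, tailStar, tsum_mul_tailSum]
    have h (m : ℕ) : (∑ n ∈ range (m + 1), ENNReal.ofReal (kernel n k / (n : ℝ) ^ 2)) *
        (ENNReal.ofReal (((m : ℝ) ^ 2)⁻¹) * tailStar (List.replicate q 2) m) =
          ENNReal.ofReal (((k : ℝ) ^ 2)⁻¹) *
            (ENNReal.ofReal (kernel m k / (m : ℝ) ^ 2) * tailStar (List.replicate q 2) m) := by
      rw [← ENNReal.ofReal_sum_of_nonneg fun i _ => hnonneg i, sum_kernel_div_sq _ hk,
        ← mul_assoc, ← mul_assoc,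
        ← ENNReal.ofReal_mul (div_nonneg (kernel_nonneg _ _) (by positivity)),
        ← ENNReal.ofReal_mul (by positivity)]
      congr 2
      ring
    simp_rw [h]
    rw [ENNReal.tsum_mul_left, ih, ← ENNReal.ofReal_mul (by positivity), ← mul_inv, ← pow_add,
      show 2 + (2 * q + 2) = 2 * (q + 1) + 2 by ring]

lemma tsum_kernel_div_mul_tailStar (q : ℕ) {k : ℕ} (hk : k ≠ 0) :
    ∑' n : ℕ, ENNReal.ofReal (kernel n k / n) * tailStar (List.replicate (q + 1) 2) n =
      ∑' j : ℕ, ENNReal.ofReal (weight k j * ((j : ℝ) ^ (2 * q + 3))⁻¹) := by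
  have hnonneg (j n : ℕ) : 0 ≤ kernel n j / (n : ℝ) :=
    div_nonneg (kernel_nonneg _ _) (by positivity)
  rw [List.replicate_succ, tailStar, tsum_mul_tailSum]
  have h (m : ℕ) : (∑ n ∈ range (m + 1), ENNReal.ofReal (kernel n k / n)) *
      (ENNReal.ofReal (((m : ℝ) ^ 2)⁻¹) * tailStar (List.replicate q 2) m) =
        ∑' j : ℕ, ENNReal.ofReal (weight k j / j) *
          (ENNReal.ofReal (kernel m j / (m : ℝ) ^ 2) * tailStar (List.replicate q 2) m) := by
    have hterm (j : ℕ) : ENNReal.ofReal (weight k j * (kernel m j / j)) *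
        (ENNReal.ofReal (((m : ℝ) ^ 2)⁻¹) * tailStar (List.replicate q 2) m) =
          ENNReal.ofReal (weight k j / j) *
            (ENNReal.ofReal (kernel m j / (m : ℝ) ^ 2) * tailStar (List.replicate q 2) m) := by
      have h1 := weight_nonneg k j
      have h2 := kernel_nonneg m j
      rw [← mul_assoc, ← mul_assoc, ← ENNReal.ofReal_mul (by positivity),
        ← ENNReal.ofReal_mul (by positivity)]
      congr 2
      ring
    rw [← ENNReal.ofReal_sum_of_nonneg fun i _ => hnonneg k i, sum_kernel_div _ hk,
      ENNReal.ofReal_sum_of_nonneg, sum_mul, tsum_eq_sum (s := range (m + 1))]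
    · exact sum_congr rfl fun j _ => hterm j
    · intro j hj
      rw [kernel_eq_zero (by rw [mem_range] at hj; omega)]
      simp
    · exact fun j _ => mul_nonneg (weight_nonneg _ _)
        (div_nonneg (kernel_nonneg _ _) (by positivity))
  simp_rw [h]
  rw [ENNReal.tsum_comm]
  refine tsum_congr fun j => ?_
  rcases eq_or_ne j 0 with rfl | hj
  · simp
  · rw [ENNReal.tsum_mul_left, tsum_kernel_div_sq_mul_tailStar q hj,
      ← ENNReal.ofReal_mul (div_nonneg (weight_nonneg _ _) (by positivity))]
    congr 1
    rw [pow_succ (j : ℝ) (2 * q + 2), mul_inv]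
    ring

lemma toReal_tsum_finiteStar_mul {p : ℕ} (hp : p ≠ 0) {X : ℕ → ENNReal} (hX : ∀ n, X n ≠ ⊤)
    (hfin : ∑' k : ℕ, ENNReal.ofReal ((((k + 1 : ℕ) : ℝ) ^ (2 * p))⁻¹) *
      ∑' n, ENNReal.ofReal (kernel n (k + 1)) * X n ≠ ⊤) :
    (∑' n, ENNReal.ofReal (finiteStar p n) * X n).toReal =
      2 * ∑' k : ℕ, (-1 : ℝ) ^ k / ((k + 1 : ℕ) : ℝ) ^ (2 * p) *
        (∑' n, ENNReal.ofReal (kernel n (k + 1)) * X n).toReal := by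
  let F (k n : ℕ) : ℝ :=
    (-1 : ℝ) ^ k / ((k + 1 : ℕ) : ℝ) ^ (2 * p) * (kernel n (k + 1) * (X n).toReal)
  have hsum : Summable (Function.uncurry F) := by
    simp_rw [← ENNReal.tsum_mul_left] at hfin
    rw [← ENNReal.tsum_prod (f := fun k n => ENNReal.ofReal ((((k + 1 : ℕ) : ℝ) ^ (2 * p))⁻¹) *
      (ENNReal.ofReal (kernel n (k + 1)) * X n))] at hfin
    refine Summable.of_norm ((ENNReal.summable_toReal hfin).congr fun x => ?_)
    rw [ENNReal.toReal_mul, ENNReal.toReal_mul, ENNReal.toReal_ofReal (by positivity),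
      ENNReal.toReal_ofReal (kernel_nonneg _ _)]
    simp only [Function.uncurry, F, norm_mul, norm_div, norm_pow, norm_neg, norm_one, one_pow,
      one_div, Real.norm_eq_abs, abs_of_nonneg (kernel_nonneg _ _), ENNReal.abs_toReal,
      Nat.abs_cast]
  have hfs (n : ℕ) : finiteStar p n * (X n).toReal = 2 * ∑' k, F k n := by
    have hker (k : ℕ) (hk : k ∉ range n) : F k n = 0 := by
      simp [F, kernel_eq_zero (show n < k + 1 by rw [mem_range] at hk; omega)]
    rw [tsum_eq_sum (s := range n) fun k hk => hker k hk]
    rcases eq_or_ne n 0 with rfl | hn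
    · obtain ⟨p, rfl⟩ := Nat.exists_eq_succ_of_ne_zero hp
      simp [finiteStar]
    · rw [finiteStar_eq p hn, mul_assoc, sum_mul]
      simp only [F, mul_assoc]
  rw [ENNReal.tsum_toReal_eq fun n => ENNReal.mul_ne_top ENNReal.ofReal_ne_top (hX n)]
  simp_rw [ENNReal.toReal_mul, ENNReal.toReal_ofReal (finiteStar_nonneg _ _), hfs]
  rw [tsum_mul_left, hsum.tsum_comm]
  congr 1
  refine tsum_congr fun k => ?_
  rw [tsum_mul_left,
    ENNReal.tsum_toReal_eq fun n => ENNReal.mul_ne_top ENNReal.ofReal_ne_top (hX n)]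
  simp_rw [ENNReal.toReal_mul, ENNReal.toReal_ofReal (kernel_nonneg _ _)]

lemma tsum_alternating {s : ℕ} (hs : 1 < s) :
    ∑' k : ℕ, (-1 : ℝ) ^ k / ((k + 1 : ℕ) : ℝ) ^ s =
      (1 - 2 / 2 ^ s) * ∑' n : ℕ, (((n + 1 : ℕ) : ℝ) ^ s)⁻¹ := by
  set a : ℕ → ℝ := fun n => (((n + 1 : ℕ) : ℝ) ^ s)⁻¹ with ha
  have hsa : Summable a := summable_inv_succ_pow hs
  have h0 : Summable fun k => a (2 * k) := hsa.comp_injective fun x y h => by simpa using h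
  have hodd (k : ℕ) : a (2 * k + 1) = (2 ^ s)⁻¹ * a k := by
    simp only [ha]
    rw [← mul_inv, ← mul_pow]
    push_cast
    ring
  have h1 : Summable fun k => a (2 * k + 1) := by
    simp_rw [hodd]; exact hsa.mul_left _
  have heven' (k : ℕ) : (-1 : ℝ) ^ (2 * k) / ((2 * k + 1 : ℕ) : ℝ) ^ s = a (2 * k) := by
    simp [ha, pow_mul]
  have hodd' (k : ℕ) :
      (-1 : ℝ) ^ (2 * k + 1) / ((2 * k + 1 + 1 : ℕ) : ℝ) ^ s = -a (2 * k + 1) := by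
    simp [ha, pow_succ, pow_mul, neg_div]
  have e1 := tsum_even_add_odd h0 h1
  have e2 := tsum_even_add_odd (f := fun k : ℕ => (-1 : ℝ) ^ k / ((k + 1 : ℕ) : ℝ) ^ s)
    (h0.congr fun k => (heven' k).symm) (h1.neg.congr fun k => (hodd' k).symm)
  simp_rw [heven', hodd'] at e2
  rw [tsum_neg] at e2
  have e3 : ∑' k, a (2 * k + 1) = (2 ^ s)⁻¹ * ∑' k, a k := by
    simp_rw [hodd]; exact tsum_mul_left
  rw [← e2]
  linear_combination e1 - 2 * e3

lemma mzvStar_replicate_two {m : ℕ} (hm : m ≠ 0) :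
    mzvStar (List.replicate m 2) = 2 * ∑' k : ℕ, (-1 : ℝ) ^ k / ((k + 1 : ℕ) : ℝ) ^ (2 * m) := by
  obtain ⟨p, rfl⟩ := Nat.exists_eq_succ_of_ne_zero hm
  rw [Nat.succ_eq_add_one, List.replicate_succ', mzvStar_eq_toReal,
    tailStar_replicate_append p 2 two_ne_zero]
  simp only [tailStar, mul_one]
  rcases eq_or_ne p 0 with rfl | hp
  · rw [tsum_alternating (by norm_num)]
    simp only [finiteStar, ENNReal.ofReal_one, one_mul]
    rw [ENNReal.tsum_toReal_eq fun _ => ENNReal.ofReal_ne_top]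
    have h0 (x : ℕ) : 0 ≤ ((x : ℝ) ^ 2)⁻¹ := by positivity
    simp_rw [ENNReal.toReal_ofReal (h0 _)]
    rw [(Real.summable_nat_pow_inv.2 one_lt_two).tsum_eq_zero_add]
    norm_num
    ring
  · have hB (k : ℕ) :
        ∑' n : ℕ, ENNReal.ofReal (kernel n (k + 1)) * ENNReal.ofReal (((n : ℝ) ^ 2)⁻¹) =
        ENNReal.ofReal ((((k + 1 : ℕ) : ℝ) ^ 2)⁻¹) := by
      have := tsum_kernel_div_sq_mul_tailStar 0 k.add_one_ne_zero
      simp only [List.replicate_zero, tailStar, mul_one, mul_zero, zero_add] at this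
      rw [← this]
      exact tsum_congr fun n => (ENNReal.ofReal_mul (kernel_nonneg _ _)).symm
    rw [toReal_tsum_finiteStar_mul hp fun _ => ENNReal.ofReal_ne_top]
    · congr 1
      refine tsum_congr fun k => ?_
      rw [hB, ENNReal.toReal_ofReal (by positivity), mul_add, pow_add]
      field_simp
    · have h0 (x : ℕ) : 0 ≤ (((x + 1 : ℕ) : ℝ) ^ (2 * p))⁻¹ := by positivity
      simp_rw [hB, ← ENNReal.ofReal_mul (h0 _), ← mul_inv, ← pow_add]
      exact (summable_inv_succ_pow (by omega)).tsum_ofReal_ne_top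

lemma tsum_weight_le (k : ℕ) {s : ℕ} (hs : 1 < s) :
    ∑' j : ℕ, ENNReal.ofReal (weight k j * ((j : ℝ) ^ s)⁻¹) ≤
      ENNReal.ofReal (2 * ∑' j : ℕ, ((j : ℝ) ^ s)⁻¹) := by
  have h := Real.summable_nat_pow_inv.2 hs
  rw [← tsum_mul_left, ENNReal.ofReal_tsum_of_nonneg (fun n => by positivity) (h.mul_left 2)]
  refine ENNReal.tsum_le_tsum fun j => ENNReal.ofReal_le_ofReal ?_
  gcongr
  exact weight_le_two k j

/-- Reduction of `ζ⋆({2}^p, 1, {2}^q)` to a double alternating sum. -/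
lemma mzvStar_eq_alternating_double_sum {p q : ℕ} (hp : p ≠ 0) (hq : q ≠ 0) :
    mzvStar (List.replicate p 2 ++ 1 :: List.replicate q 2) =
      2 * ∑' k : ℕ, (-1 : ℝ) ^ k / ((k + 1 : ℕ) : ℝ) ^ (2 * p) *
        ∑' j : ℕ, weight (k + 1) j * ((j : ℝ) ^ (2 * q + 1))⁻¹ := by
  obtain ⟨q, rfl⟩ := Nat.exists_eq_succ_of_ne_zero hq
  rw [Nat.succ_eq_add_one, mzvStar_eq_toReal, tailStar_replicate_append p 1 one_ne_zero]
  have hB (k : ℕ) : ∑' n : ℕ, ENNReal.ofReal (kernel n (k + 1)) *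
      (ENNReal.ofReal (((n : ℝ) ^ 1)⁻¹) * tailStar (List.replicate (q + 1) 2) n) =
        ∑' j : ℕ, ENNReal.ofReal (weight (k + 1) j * ((j : ℝ) ^ (2 * (q + 1) + 1))⁻¹) := by
    rw [show 2 * (q + 1) + 1 = 2 * q + 3 by ring,
      ← tsum_kernel_div_mul_tailStar q k.add_one_ne_zero]
    refine tsum_congr fun n => ?_
    rw [← mul_assoc, ← ENNReal.ofReal_mul (kernel_nonneg _ _), pow_one, div_eq_mul_inv]
  rw [toReal_tsum_finiteStar_mul hp fun n =>
    ENNReal.mul_ne_top ENNReal.ofReal_ne_top (tailStar_replicate_ne_top _ _)]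
  · congr 1
    refine tsum_congr fun k => ?_
    rw [hB, ENNReal.tsum_toReal_eq fun _ => ENNReal.ofReal_ne_top]
    congr 1
    refine tsum_congr fun j => ENNReal.toReal_ofReal ?_
    exact mul_nonneg (weight_nonneg _ _) (by positivity)
  · simp_rw [hB]
    refine ne_top_of_le_ne_top ?_ (ENNReal.tsum_le_tsum fun k =>
      mul_le_mul_right (tsum_weight_le (k + 1) (by omega)) _)
    rw [ENNReal.tsum_mul_right]
    exact ENNReal.mul_ne_top (summable_inv_succ_pow (by omega)).tsum_ofReal_ne_top
      ENNReal.ofReal_ne_top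

/-- The function `k ↦ k^{-a}` on the integers, extended by `0` at `k = 0` (also for `a = 0`). -/
noncomputable def invPow (a : ℕ) (k : ℤ) : ℝ := if k = 0 then 0 else ((k : ℝ) ^ a)⁻¹

lemma invPow_zero_right (a : ℕ) : invPow a 0 = 0 := if_pos rfl

lemma invPow_of_ne_zero (a : ℕ) {k : ℤ} (hk : k ≠ 0) : invPow a k = ((k : ℝ) ^ a)⁻¹ := if_neg hk

lemma invPow_eq {a : ℕ} (ha : a ≠ 0) (k : ℤ) : invPow a k = ((k : ℝ) ^ a)⁻¹ := by
  rcases eq_or_ne k 0 with rfl | hk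
  · simp [invPow_zero_right, ha]
  · exact invPow_of_ne_zero a hk

lemma invPow_neg (a : ℕ) (k : ℤ) : invPow a (-k) = (-1) ^ a * invPow a k := by
  rcases eq_or_ne k 0 with rfl | hk
  · simp [invPow_zero_right]
  · rw [invPow_of_ne_zero a hk, invPow_of_ne_zero a (neg_ne_zero.2 hk)]
    push_cast
    rw [neg_pow, mul_inv, ← inv_pow, inv_neg, inv_one]

lemma abs_invPow_le_one (a : ℕ) (k : ℤ) : |invPow a k| ≤ 1 := by
  rcases eq_or_ne k 0 with rfl | hk
  · simp [invPow_zero_right]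
  · rw [invPow_of_ne_zero a hk, abs_inv, abs_pow]
    refine inv_le_one_of_one_le₀ (one_le_pow₀ ?_)
    exact_mod_cast Int.one_le_abs hk

lemma summable_invPow {a : ℕ} (ha : 1 < a) : Summable (invPow a) := by
  refine (Real.summable_one_div_int_pow.2 ha).congr fun k => ?_
  rw [invPow_eq (by omega), one_div]

lemma norm_neg_one_zpow (k : ℤ) : ‖(-1 : ℝ) ^ k‖ = 1 := by simp

lemma summable_alternating_invPow_mul {a b : ℕ} (hab : 2 ≤ a + b) (j : ℤ) :
    Summable fun k : ℤ => (-1 : ℝ) ^ k * (invPow a k * invPow b (k + j)) := by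
  have hshift {b : ℕ} (hb : 1 < b) : Summable fun k : ℤ => |invPow b (k + j)| :=
    ((Equiv.addRight j).summable_iff.2 (summable_invPow hb)).abs
  refine Summable.of_norm ?_
  simp_rw [norm_mul, norm_neg_one_zpow, one_mul, Real.norm_eq_abs]
  rcases lt_or_ge 1 a with ha | ha
  · refine (summable_invPow ha).abs.of_nonneg_of_le (fun k => by positivity) fun k => ?_
    exact mul_le_of_le_one_right (abs_nonneg _) (abs_invPow_le_one _ _)
  rcases lt_or_ge 1 b with hb | hb
  · refine (hshift hb).of_nonneg_of_le (fun k => by positivity) fun k => ?_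
    exact mul_le_of_le_one_left (abs_nonneg _) (abs_invPow_le_one _ _)
  obtain rfl : a = 1 := by omega
  obtain rfl : b = 1 := by omega
  refine ((summable_invPow one_lt_two).abs.add (hshift one_lt_two)).of_nonneg_of_le
    (fun k => by positivity) fun k => ?_
  have hsq (k : ℤ) : |invPow 2 k| = |invPow 1 k| ^ 2 := by
    rw [invPow_eq two_ne_zero, invPow_eq one_ne_zero, pow_one, ← abs_pow, inv_pow]
  rw [hsq, hsq]
  nlinarith [sq_nonneg (|invPow 1 k| - |invPow 1 (k + j)|), sq_nonneg |invPow 1 k|,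
    sq_nonneg |invPow 1 (k + j)|]

lemma invPow_mul_invPow (a b : ℕ) {j : ℤ} (hj : j ≠ 0) (k : ℤ) :
    invPow (a + 1) k * invPow (b + 1) (k + j) =
      (j : ℝ)⁻¹ * (invPow (a + 1) k * invPow b (k + j) - invPow a k * invPow (b + 1) (k + j)) := by
  rcases eq_or_ne k 0 with rfl | hk
  · simp [invPow_zero_right]
  rcases eq_or_ne (k + j) 0 with hkj | hkj
  · simp [hkj, invPow_zero_right]
  · simp_rw [invPow_of_ne_zero _ hk, invPow_of_ne_zero _ hkj]
    have h1 : (k : ℝ) ≠ 0 := by exact_mod_cast hk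
    have h2 : (k : ℝ) + j ≠ 0 := by exact_mod_cast hkj
    have h3 : (j : ℝ) ≠ 0 := by exact_mod_cast hj
    push_cast
    field_simp
    ring

/-- The alternating bilateral sum `∑_{k ≠ 0, -j} (-1)^k k^{-a} (k + j)^{-b}`. -/
noncomputable def bilateral (j : ℤ) (a b : ℕ) : ℝ :=
  ∑' k : ℤ, (-1 : ℝ) ^ k * (invPow a k * invPow b (k + j))

lemma bilateral_succ_succ {j : ℤ} (hj : j ≠ 0) {a b : ℕ} (hab : 1 ≤ a + b) :
    bilateral j (a + 1) (b + 1) =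
      (j : ℝ)⁻¹ * (bilateral j (a + 1) b - bilateral j a (b + 1)) := by
  rw [bilateral, bilateral, bilateral, ← Summable.tsum_sub
    (summable_alternating_invPow_mul (by omega) j) (summable_alternating_invPow_mul (by omega) j),
    ← tsum_mul_left]
  refine tsum_congr fun k => ?_
  rw [invPow_mul_invPow a b hj]
  ring

lemma bilateral_zero_right (j : ℤ) {a : ℕ} (ha : 1 < a) :
    bilateral j a 0 =
      (∑' k : ℤ, (-1 : ℝ) ^ k * invPow a k) - (-1) ^ j * ((-1) ^ a * invPow a j) := by
  have h1 : Summable fun k : ℤ => (-1 : ℝ) ^ k * invPow a k :=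
    Summable.of_norm (by simpa [norm_mul] using (summable_invPow ha).abs)
  have h2 : HasSum (fun k : ℤ => if k = -j then (-1 : ℝ) ^ (-j) * invPow a (-j) else 0)
      ((-1 : ℝ) ^ (-j) * invPow a (-j)) := hasSum_ite_eq _ _
  have h3 : (-1 : ℝ) ^ (-j) = (-1) ^ j := by rw [zpow_neg, ← inv_zpow, inv_neg, inv_one]
  rw [← invPow_neg, ← h3, bilateral, ← h2.tsum_eq, ← h1.tsum_sub h2.summable]
  refine tsum_congr fun k => ?_
  split_ifs with hk
  · subst hk
    simp [invPow_zero_right]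
  · rw [invPow_of_ne_zero 0 (show k + j ≠ 0 by omega)]
    simp

lemma bilateral_zero_left (j : ℤ) {b : ℕ} (hb : 1 < b) :
    bilateral j 0 b = (-1) ^ j * (∑' k : ℤ, (-1 : ℝ) ^ k * invPow b k) - invPow b j := by
  have h1 : Summable fun k : ℤ => (-1 : ℝ) ^ k * invPow b k :=
    Summable.of_norm (by simpa [norm_mul] using (summable_invPow hb).abs)
  have h1' : Summable fun k : ℤ => (-1 : ℝ) ^ j * ((-1 : ℝ) ^ (k + j) * invPow b (k + j)) :=
    ((Equiv.addRight j).summable_iff.2 h1).mul_left _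
  have h2 : HasSum (fun k : ℤ => if k = 0 then invPow b j else 0) (invPow b j) :=
    hasSum_ite_eq _ _
  rw [bilateral, ← (Equiv.addRight j).tsum_eq fun k : ℤ => (-1 : ℝ) ^ k * invPow b k,
    ← tsum_mul_left]
  simp only [Equiv.coe_addRight]
  rw [← h2.tsum_eq, ← h1'.tsum_sub h2.summable]
  refine tsum_congr fun k => ?_
  have h3 : (-1 : ℝ) ^ j * (-1) ^ (k + j) = (-1) ^ k := by
    rw [zpow_add₀ (by norm_num), mul_comm, mul_assoc, ← mul_zpow]
    simp
  rw [← mul_assoc ((-1 : ℝ) ^ j), h3]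
  split_ifs with hk
  · subst hk
    simp [invPow_zero_right]
  · rw [invPow_of_ne_zero 0 hk]
    simp

lemma hasSum_alternating_telescope (j : ℕ) :
    HasSum (fun k : ℤ => (-1 : ℝ) ^ k * (invPow 1 k - invPow 1 (k + j))) 0 := by
  have hD : Summable fun k : ℤ => (-1 : ℝ) ^ k * (invPow 1 k - invPow 1 (k + 1)) := by
    have h0 := summable_alternating_invPow_mul (a := 1) (b := 1) le_rfl 1
    have h1 := (hasSum_ite_eq (0 : ℤ) (-1 : ℝ)).summable
    have h2 := (hasSum_ite_eq (-1 : ℤ) (1 : ℝ)).summable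
    refine ((h0.add h1).add h2).congr fun k => ?_
    rcases eq_or_ne k 0 with rfl | hk
    · simp [invPow]
    rcases eq_or_ne k (-1) with rfl | hk1
    · simp [invPow]
    · have e := invPow_mul_invPow 0 0 one_ne_zero k
      rw [invPow_of_ne_zero 0 hk, invPow_of_ne_zero 0 (show k + 1 ≠ 0 by omega)] at e
      simp only [zero_add] at e
      rw [if_neg hk, if_neg hk1, e]
      simp
  have hone : HasSum (fun k : ℤ => (-1 : ℝ) ^ k * (invPow 1 k - invPow 1 (k + 1))) 0 := by
    have h := (Equiv.subLeft (-1 : ℤ)).tsum_eq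
      fun k : ℤ => (-1 : ℝ) ^ k * (invPow 1 k - invPow 1 (k + 1))
    have hneg (k : ℤ) : (-1 : ℝ) ^ (-1 - k) *
        (invPow 1 (-1 - k) - invPow 1 (-1 - k + 1)) =
          -((-1 : ℝ) ^ k * (invPow 1 k - invPow 1 (k + 1))) := by
      rw [show (-1 - k : ℤ) = -(k + 1) by ring, show -(k + 1) + 1 = -k by ring, invPow_neg,
        invPow_neg, zpow_neg, ← inv_zpow, inv_neg, inv_one, zpow_add₀ (by norm_num)]
      ring
    simp only [Equiv.subLeft_apply, hneg] at h
    rw [tsum_neg] at h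
    convert hD.hasSum using 1
    linarith
  induction j with
  | zero => simp
  | succ j ih =>
    have hs := ((Equiv.addRight (j : ℤ)).hasSum_iff.2 hone).mul_left ((-1 : ℝ) ^ j)
    have := ih.add hs
    rw [mul_zero, add_zero] at this
    refine this.congr_fun fun k => ?_
    simp only [Function.comp, Equiv.coe_addRight]
    rw [zpow_add₀ (by norm_num), zpow_natCast]
    have h1 : (-1 : ℝ) ^ j * (-1) ^ j = 1 := by rw [← mul_pow]; simp
    push_cast
    rw [← add_assoc]
    linear_combination
      ((-1 : ℝ) ^ k * (invPow 1 (k + j + 1) - invPow 1 (k + j))) * h1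

lemma bilateral_one_one {j : ℕ} (hj : j ≠ 0) :
    bilateral j 1 1 = (1 + (-1) ^ j) / (j : ℝ) ^ 2 := by
  have hj' : (j : ℝ) ≠ 0 := by exact_mod_cast hj
  have h1 := hasSum_ite_eq (0 : ℤ) ((j : ℝ)⁻¹)
  have h2 := hasSum_ite_eq (-j : ℤ) ((-1 : ℝ) ^ j * (j : ℝ)⁻¹)
  have h := (((hasSum_alternating_telescope j).add h1).add h2).mul_left ((j : ℝ)⁻¹)
  rw [bilateral]
  convert h.tsum_eq using 1
  · refine tsum_congr fun k => ?_
    rcases eq_or_ne k 0 with rfl | hk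
    · rw [if_pos rfl, if_neg (by omega), invPow_zero_right, zero_add, invPow_eq one_ne_zero]
      simp
    rcases eq_or_ne k (-j) with rfl | hk1
    · rw [if_neg hk, if_pos rfl, neg_add_cancel, invPow_zero_right, invPow_eq one_ne_zero]
      rw [zpow_neg, ← inv_zpow, inv_neg, inv_one, zpow_natCast]
      push_cast
      rw [pow_one, inv_neg]
      ring
    · have e := invPow_mul_invPow 0 0 (show (j : ℤ) ≠ 0 by omega) k
      rw [invPow_of_ne_zero 0 hk, invPow_of_ne_zero 0 (show k + (j : ℤ) ≠ 0 by omega)] at e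
      simp only [zero_add] at e
      rw [if_neg hk, if_neg hk1, e]
      push_cast
      ring
  · field_simp
    ring

lemma tsum_int_eq_tsum_pairs {f : ℤ → ℝ} (hf : Summable f) (h0 : f 0 = 0) :
    ∑' k, f k = ∑' l : ℕ, (f (l + 1) + f (-(l + 1))) := by
  have h1 : Summable fun n : ℕ => f n := hf.comp_injective Nat.cast_injective
  have h2 : Summable fun n : ℕ => f (-(n + 1)) :=
    hf.comp_injective fun x y h => by simpa using h
  have h3 : Summable fun n : ℕ => f (n + 1) :=
    hf.comp_injective fun x y h => by simpa using h
  rw [tsum_of_nat_of_neg_add_one h1 h2, h1.tsum_eq_zero_add, h3.tsum_add h2]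
  simp [h0]

/-- The Taylor coefficients of `π s / sin (π s)`: the coefficient of `s^{2m}` is `ζ⋆({2}^m)`. -/
noncomputable def cosecCoeff (r : ℕ) : ℝ :=
  if Even r then mzvStar (List.replicate (r / 2) 2) else 0

lemma cosecCoeff_zero : cosecCoeff 0 = 1 := by
  simp [cosecCoeff, mzvStar_eq_toReal, tailStar]

lemma cosecCoeff_of_odd {r : ℕ} (hr : Odd r) : cosecCoeff r = 0 :=
  if_neg (Nat.not_even_iff_odd.2 hr)

lemma cosecCoeff_two_mul (m : ℕ) : cosecCoeff (2 * m) = mzvStar (List.replicate m 2) := by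
  simp [cosecCoeff]

lemma tsum_alternating_invPow {r : ℕ} (hr : 1 < r) :
    ∑' k : ℤ, (-1 : ℝ) ^ k * invPow r k = -cosecCoeff r := by
  have hs : Summable fun k : ℤ => (-1 : ℝ) ^ k * invPow r k :=
    Summable.of_norm (by simpa [norm_mul] using (summable_invPow hr).abs)
  rw [tsum_int_eq_tsum_pairs hs (by simp [invPow_zero_right])]
  have hpair (l : ℕ) : (-1 : ℝ) ^ ((l : ℤ) + 1) * invPow r (l + 1) +
      (-1 : ℝ) ^ (-((l : ℤ) + 1)) * invPow r (-(l + 1)) =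
        -(1 + (-1) ^ r) * ((-1 : ℝ) ^ l / ((l + 1 : ℕ) : ℝ) ^ r) := by
    rw [invPow_neg, zpow_neg, ← inv_zpow, inv_neg, inv_one, zpow_add₀ (by norm_num), zpow_one,
      zpow_natCast, invPow_eq (by omega)]
    push_cast
    ring
  simp_rw [hpair]
  rw [tsum_mul_left]
  rcases Nat.even_or_odd r with h | h
  · obtain ⟨m, rfl⟩ := h.exists_two_nsmul
    rw [smul_eq_mul, cosecCoeff_two_mul, mzvStar_replicate_two (by rintro rfl; simp at hr)]
    simp [pow_mul]
    ring
  · rw [cosecCoeff_of_odd h, h.neg_one_pow]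
    simp

/-- The coefficient of `s^n` in `(j + s)^{-b}`. -/
noncomputable def addPowCoeff (j : ℝ) (b n : ℕ) : ℝ :=
  (-1) ^ n * (b + n - 1).choose n * (j ^ (b + n))⁻¹

/-- The coefficient of `s^n` in `(s - j)^{-a}`. -/
noncomputable def subPowCoeff (j : ℝ) (a n : ℕ) : ℝ :=
  (-1) ^ a * (a + n - 1).choose n * (j ^ (a + n))⁻¹

lemma addPowCoeff_succ_zero {j : ℝ} (hj : j ≠ 0) (b : ℕ) :
    j * addPowCoeff j (b + 1) 0 = addPowCoeff j b 0 := by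
  simp [addPowCoeff]
  field_simp
  ring

lemma addPowCoeff_succ_succ {j : ℝ} (hj : j ≠ 0) (b n : ℕ) :
    j * addPowCoeff j (b + 1) (n + 1) + addPowCoeff j (b + 1) n = addPowCoeff j b (n + 1) := by
  simp only [addPowCoeff, show b + 1 + (n + 1) - 1 = b + n + 1 by omega,
    show b + 1 + n - 1 = b + n by omega, show b + (n + 1) - 1 = b + n by omega,
    Nat.choose_succ_succ]
  push_cast
  field_simp
  ring

lemma subPowCoeff_succ_zero {j : ℝ} (hj : j ≠ 0) (a : ℕ) :
    -(j * subPowCoeff j (a + 1) 0) = subPowCoeff j a 0 := by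
  simp [subPowCoeff]
  field_simp
  ring

lemma subPowCoeff_succ_succ {j : ℝ} (hj : j ≠ 0) (a n : ℕ) :
    subPowCoeff j (a + 1) n - j * subPowCoeff j (a + 1) (n + 1) = subPowCoeff j a (n + 1) := by
  simp only [subPowCoeff, show a + 1 + (n + 1) - 1 = a + n + 1 by omega,
    show a + 1 + n - 1 = a + n by omega, show a + (n + 1) - 1 = a + n by omega,
    Nat.choose_succ_succ]
  push_cast
  field_simp
  ring

lemma addPowCoeff_zero_left (j : ℝ) (n : ℕ) : addPowCoeff j 0 n = if n = 0 then 1 else 0 := by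
  rcases n with _ | n <;> simp [addPowCoeff]

lemma subPowCoeff_zero_left (j : ℝ) (n : ℕ) : subPowCoeff j 0 n = if n = 0 then 1 else 0 := by
  rcases n with _ | n <;> simp [subPowCoeff]

/-- The sum of the residues at `0` and `-j` of `π / sin (π s) * s^{-a} * (s + j)^{-b}`. -/
noncomputable def residueSum (j a b : ℕ) : ℝ :=
  ∑ x ∈ antidiagonal a, cosecCoeff x.1 * addPowCoeff j b x.2 +
    (-1) ^ j * ∑ x ∈ antidiagonal b, cosecCoeff x.1 * subPowCoeff j a x.2

lemma residueSum_succ_succ {j : ℕ} (hj : j ≠ 0) (a b : ℕ) :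
    residueSum j (a + 1) (b + 1) =
      (j : ℝ)⁻¹ * (residueSum j (a + 1) b - residueSum j a (b + 1)) := by
  have hj' : (j : ℝ) ≠ 0 := by exact_mod_cast hj
  have h1 : ∑ x ∈ antidiagonal (a + 1), cosecCoeff x.1 * addPowCoeff j b x.2 =
      j * ∑ x ∈ antidiagonal (a + 1), cosecCoeff x.1 * addPowCoeff j (b + 1) x.2 +
        ∑ x ∈ antidiagonal a, cosecCoeff x.1 * addPowCoeff j (b + 1) x.2 := by
    rw [Finset.Nat.sum_antidiagonal_succ', Finset.Nat.sum_antidiagonal_succ', mul_add, mul_sum,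
      add_assoc, ← sum_add_distrib, ← addPowCoeff_succ_zero hj' b]
    congr 1
    · ring
    · refine sum_congr rfl fun x _ => ?_
      rw [← addPowCoeff_succ_succ hj']
      ring
  have h2 : ∑ x ∈ antidiagonal (b + 1), cosecCoeff x.1 * subPowCoeff j a x.2 =
      ∑ x ∈ antidiagonal b, cosecCoeff x.1 * subPowCoeff j (a + 1) x.2 -
        j * ∑ x ∈ antidiagonal (b + 1), cosecCoeff x.1 * subPowCoeff j (a + 1) x.2 := by
    rw [Finset.Nat.sum_antidiagonal_succ', Finset.Nat.sum_antidiagonal_succ', mul_add, mul_sum,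
      sub_add_eq_sub_sub_swap, sub_sub, add_comm, ← sub_sub, ← sum_sub_distrib, sub_eq_add_neg,
      ← subPowCoeff_succ_zero hj' a]
    congr 1
    · refine sum_congr rfl fun x _ => ?_
      rw [← subPowCoeff_succ_succ hj']
      ring
    · ring
  simp only [residueSum]
  rw [h1, h2]
  field_simp
  ring

lemma residueSum_zero_right (j a : ℕ) :
    residueSum j a 0 = cosecCoeff a + (-1) ^ j * ((-1) ^ a * ((j : ℝ) ^ a)⁻¹) := by
  have h : ∑ x ∈ antidiagonal a, cosecCoeff x.1 * addPowCoeff j 0 x.2 = cosecCoeff a := by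
    rw [sum_eq_single_of_mem (a, 0) (by simp)]
    · simp [addPowCoeff_zero_left]
    · rintro ⟨x, y⟩ hx hne
      rw [addPowCoeff_zero_left, if_neg, mul_zero]
      rintro rfl
      simp_all
  simp [residueSum, h, cosecCoeff_zero, subPowCoeff]

lemma residueSum_zero_left (j b : ℕ) :
    residueSum j 0 b = ((j : ℝ) ^ b)⁻¹ + (-1) ^ j * cosecCoeff b := by
  have h : ∑ x ∈ antidiagonal b, cosecCoeff x.1 * subPowCoeff j 0 x.2 = cosecCoeff b := by
    rw [sum_eq_single_of_mem (b, 0) (by simp)]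
    · simp [subPowCoeff_zero_left]
    · rintro ⟨x, y⟩ hx hne
      rw [subPowCoeff_zero_left, if_neg, mul_zero]
      rintro rfl
      simp_all
  simp [residueSum, h, cosecCoeff_zero, addPowCoeff]

lemma bilateral_eq_neg_residueSum {j : ℕ} (hj : j ≠ 0) {a b : ℕ} (hab : 2 ≤ a + b) :
    bilateral j a b = -residueSum j a b := by
  have hjz : (j : ℤ) ≠ 0 := by exact_mod_cast hj
  induction a generalizing b with
  | zero =>
    rw [bilateral_zero_left _ (by omega), tsum_alternating_invPow (by omega),
      residueSum_zero_left, invPow_of_ne_zero _ hjz, zpow_natCast]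
    push_cast
    ring
  | succ a iha =>
    induction b with
    | zero =>
      rw [bilateral_zero_right _ (by omega), tsum_alternating_invPow (by omega),
        residueSum_zero_right, invPow_of_ne_zero _ hjz, zpow_natCast]
      push_cast
      ring
    | succ b ihb =>
      rcases Nat.eq_zero_or_pos (a + b) with h | h
      · obtain ⟨rfl, rfl⟩ : a = 0 ∧ b = 0 := by omega
        have hodd : cosecCoeff 1 = 0 := cosecCoeff_of_odd odd_one
        rw [zero_add, bilateral_one_one hj]
        simp [residueSum, Finset.Nat.antidiagonal_succ, cosecCoeff_zero, hodd, addPowCoeff,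
          subPowCoeff]
        ring
      · rw [bilateral_succ_succ hjz h, residueSum_succ_succ hj, ihb (by omega), iha (by omega)]
        push_cast
        ring

/-- The sum of `m^{-b}` over the nonzero integers `m > k`. -/
noncomputable def invPowTail (b : ℕ) (k : ℤ) : ℝ := ∑' j : ℕ, invPow b (k + ((j + 1 : ℕ) : ℤ))

lemma invPowTail_eq {b : ℕ} (hb : 1 < b) (k : ℤ) :
    invPowTail b k = invPow b (k + 1) + invPowTail b (k + 1) := by
  have hs : Summable fun j : ℕ => invPow b (k + ((j + 1 : ℕ) : ℤ)) :=
    (summable_invPow hb).comp_injective fun x y h => by simpa using h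
  rw [invPowTail, hs.tsum_eq_zero_add, invPowTail]
  congr 1
  refine tsum_congr fun j => ?_
  congr 1
  push_cast
  ring

lemma invPowTail_neg {b : ℕ} (hb : 1 < b) (hodd : Odd b) (l : ℕ) :
    invPowTail b (-(l + 1)) = invPowTail b l := by
  induction l with
  | zero =>
    rw [invPowTail_eq hb]
    simp [invPow_zero_right]
  | succ l ih =>
    have h1 := invPowTail_eq hb (-(((l + 1 : ℕ) : ℤ) + 1))
    rw [show (-(((l + 1 : ℕ) : ℤ) + 1) + 1) = -((l : ℤ) + 1) by push_cast; ring, ih, invPow_neg,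
      hodd.neg_one_pow, invPowTail_eq hb l] at h1
    rw [h1]
    push_cast
    ring

lemma tsum_weight_mul_inv_pow {b : ℕ} (hb : 1 < b) (l : ℕ) :
    ∑' j : ℕ, weight (l + 1) j * ((j : ℝ) ^ b)⁻¹ =
      invPow b (l + 1) + 2 * invPowTail b (l + 1) := by
  have hs : Summable fun j : ℕ => weight (l + 1) j * ((j : ℝ) ^ b)⁻¹ := by
    refine ((Real.summable_nat_pow_inv.2 hb).mul_left 2).of_nonneg_of_le
      (fun j => mul_nonneg (weight_nonneg _ _) (by positivity)) fun j => ?_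
    exact mul_le_mul_of_nonneg_right (weight_le_two _ _) (by positivity)
  have h0 : ∑ j ∈ range (l + 1), weight (l + 1) j * ((j : ℝ) ^ b)⁻¹ = 0 :=
    sum_eq_zero fun j hj => by rw [weight, if_pos (mem_range.1 hj), zero_mul]
  rw [← hs.sum_add_tsum_nat_add (l + 2), sum_range_succ, h0, zero_add, invPowTail, ← tsum_mul_left]
  congr 1
  · rw [invPow_eq (by omega)]
    simp [weight]
  · refine tsum_congr fun j => ?_
    rw [weight, if_neg (by omega), if_neg (by omega), invPow_eq (by omega)]
    push_cast
    ring_nf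

lemma tsum_bilateral {a b : ℕ} (ha : 1 < a) (hb : 1 < b) :
    ∑' j : ℕ, bilateral ((j + 1 : ℕ) : ℤ) a b =
      ∑' k : ℤ, (-1 : ℝ) ^ k * (invPow a k * invPowTail b k) ∧
    Summable fun k : ℤ => (-1 : ℝ) ^ k * (invPow a k * invPowTail b k) := by
  have h1 : Summable fun x : ℤ × ℤ => |invPow a x.1| * |invPow b x.2| :=
    (summable_invPow ha).abs.mul_of_nonneg (summable_invPow hb).abs
      (fun _ => abs_nonneg _) fun _ => abs_nonneg _
  have hinj : Function.Injective fun x : ℤ × ℕ => (x.1, x.1 + ((x.2 + 1 : ℕ) : ℤ)) := by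
    rintro ⟨x, y⟩ ⟨x', y'⟩ h
    simp only [Prod.mk.injEq] at h ⊢
    omega
  have h2 : Summable fun x : ℤ × ℕ =>
      (-1 : ℝ) ^ x.1 * (invPow a x.1 * invPow b (x.1 + ((x.2 + 1 : ℕ) : ℤ))) := by
    refine Summable.of_norm ((h1.comp_injective hinj).congr fun x => ?_)
    simp [Function.comp]
  have h3 (k : ℤ) : ∑' j : ℕ, (-1 : ℝ) ^ k * (invPow a k * invPow b (k + ((j + 1 : ℕ) : ℤ))) =
      (-1 : ℝ) ^ k * (invPow a k * invPowTail b k) := by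
    rw [tsum_mul_left, tsum_mul_left, invPowTail]
  refine ⟨?_, h2.prod.congr h3⟩
  simp_rw [bilateral, ← h3]
  exact Summable.tsum_comm (f := fun (k : ℤ) (j : ℕ) =>
    (-1 : ℝ) ^ k * (invPow a k * invPow b (k + ((j + 1 : ℕ) : ℤ)))) h2

lemma tsum_alternating_weight {a b : ℕ} (ha : 1 < a) (hb : 1 < b) (ha' : Even a) (hb' : Odd b) :
    ∑' k : ℕ, (-1 : ℝ) ^ k / ((k + 1 : ℕ) : ℝ) ^ a * ∑' j : ℕ, weight (k + 1) j * ((j : ℝ) ^ b)⁻¹ =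
      ∑' j : ℕ, residueSum (j + 1) a b := by
  obtain ⟨h1, h2⟩ := tsum_bilateral ha hb
  simp_rw [bilateral_eq_neg_residueSum (Nat.succ_ne_zero _) (show 2 ≤ a + b by omega)] at h1
  rw [tsum_neg, tsum_int_eq_tsum_pairs h2 (by simp [invPow_zero_right])] at h1
  rw [← neg_inj, h1, ← tsum_neg]
  refine tsum_congr fun l => ?_
  rw [tsum_weight_mul_inv_pow hb, invPowTail_neg hb hb', invPowTail_eq hb l, invPow_neg,
    ha'.neg_one_pow, zpow_neg, ← inv_zpow, inv_neg, inv_one, zpow_add₀ (by norm_num), zpow_one,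
    zpow_natCast, invPow_eq (by omega : a ≠ 0)]
  push_cast
  ring

lemma hasSum_addPowCoeff {b n : ℕ} (h : 1 < b + n) :
    HasSum (fun j : ℕ => addPowCoeff ((j + 1 : ℕ) : ℝ) b n)
      ((-1) ^ n * (b + n - 1).choose n * mzv [b + n]) := by
  rw [mzv_singleton]
  exact (summable_inv_succ_pow h).hasSum.mul_left _

lemma hasSum_alternating_subPowCoeff {a n : ℕ} (h : 1 < a + n) :
    HasSum (fun j : ℕ => (-1 : ℝ) ^ (j + 1) * subPowCoeff ((j + 1 : ℕ) : ℝ) a n)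
      (-((-1) ^ a * (a + n - 1).choose n * ((1 - 2 / 2 ^ (a + n)) * mzv [a + n]))) := by
  have hs : Summable fun k : ℕ => (-1 : ℝ) ^ k / ((k + 1 : ℕ) : ℝ) ^ (a + n) := by
    refine Summable.of_norm ((summable_inv_succ_pow h).congr fun k => ?_)
    rw [norm_div, norm_pow, norm_neg, norm_one, one_pow, norm_pow, Real.norm_natCast, one_div]
  rw [mzv_singleton, ← tsum_alternating h, ← neg_mul]
  refine (hs.hasSum.mul_left _).congr_fun fun j => ?_
  rw [subPowCoeff]
  ring

lemma tsum_residueSum {a b : ℕ} (ha : 1 < a) (hb : 1 < b) (ha' : Even a) :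
    ∑' j : ℕ, residueSum (j + 1) a b =
      ∑ x ∈ antidiagonal a,
          cosecCoeff x.1 * ((-1) ^ x.2 * (b + x.2 - 1).choose x.2 * mzv [b + x.2]) -
        ∑ x ∈ antidiagonal b,
          cosecCoeff x.1 * ((a + x.2 - 1).choose x.2 * ((1 - 2 / 2 ^ (a + x.2)) *
            mzv [a + x.2])) := by
  have h1 := hasSum_sum (s := antidiagonal a) fun x _ =>
    (hasSum_addPowCoeff (b := b) (n := x.2) (by omega)).mul_left (cosecCoeff x.1)
  have h2 := hasSum_sum (s := antidiagonal b) fun x _ =>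
    (hasSum_alternating_subPowCoeff (a := a) (n := x.2) (by omega)).mul_left (cosecCoeff x.1)
  rw [sub_eq_add_neg, ← sum_neg_distrib]
  convert (h1.add h2).tsum_eq using 1
  · refine tsum_congr fun j => ?_
    rw [residueSum, mul_sum]
    congr 1
    refine sum_congr rfl fun x _ => ?_
    ring
  · congr 1
    refine sum_congr rfl fun x _ => ?_
    rw [ha'.neg_one_pow]
    ring

lemma sum_antidiagonal_cosecCoeff_mul (N : ℕ) (F : ℕ → ℝ) :
    ∑ x ∈ antidiagonal N, cosecCoeff x.1 * F x.2 =
      ∑ m ∈ range (N / 2 + 1), mzvStar (List.replicate m 2) * F (N - 2 * m) := by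
  rw [Finset.Nat.sum_antidiagonal_eq_sum_range_succ_mk]
  symm
  refine sum_of_injOn (fun m => 2 * m) (fun x _ y _ h => by simpa using h) ?_ ?_ ?_
  · intro m hm
    simp only [coe_range, Set.mem_Iio] at hm ⊢
    omega
  · intro r hr hr'
    rcases Nat.even_or_odd' r with ⟨m, rfl | rfl⟩
    · refine absurd ⟨m, ?_, rfl⟩ hr'
      simp only [mem_range, coe_range, Set.mem_Iio] at hr ⊢
      omega
    · rw [cosecCoeff_of_odd (odd_two_mul_add_one m), zero_mul]
  · intro m _
    rw [cosecCoeff_two_mul]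

end MzvStar

open Finset MzvStar in
/-- Evaluation of `ζ⋆({2}^p, 1, {2}^q)`. -/
theorem stmt_7 (p q : ℕ) (hp : 0 < p) (hq : 0 < q) :
    mzvStar (List.replicate p 2 ++ 1 :: List.replicate q 2) =
      2 * ∑ k ∈ Finset.Icc 1 (p + q),
        ((Nat.choose (2 * k) (2 * q) : ℝ) -
            (1 - 1 / 2 ^ (2 * k)) * Nat.choose (2 * k) (2 * p - 1)) *
          mzvStar (List.replicate (p + q - k) 2) * mzv [2 * k + 1] := by
  rw [mzvStar_eq_alternating_double_sum hp.ne' hq.ne',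
    tsum_alternating_weight (by omega) (by omega) (even_two_mul p) (odd_two_mul_add_one q),
    tsum_residueSum (by omega) (by omega) (even_two_mul p),
    sum_antidiagonal_cosecCoeff_mul (2 * p) fun n =>
      (-1) ^ n * (2 * q + 1 + n - 1).choose n * mzv [2 * q + 1 + n],
    sum_antidiagonal_cosecCoeff_mul (2 * q + 1) fun n =>
      (2 * p + n - 1).choose n * ((1 - 2 / 2 ^ (2 * p + n)) * mzv [2 * p + n])]
  congr 1
  have h1 : ∑ m ∈ range (2 * p / 2 + 1), mzvStar (List.replicate m 2) *
      ((-1) ^ (2 * p - 2 * m) * (2 * q + 1 + (2 * p - 2 * m) - 1).choose (2 * p - 2 * m) *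
        mzv [2 * q + 1 + (2 * p - 2 * m)]) =
      ∑ m ∈ range (p + q), mzvStar (List.replicate m 2) *
        ((2 * (p + q - m)).choose (2 * q) * mzv [2 * (p + q - m) + 1]) := by
    refine sum_subset_zero_on_sdiff (range_subset_range.2 (by omega)) ?_ ?_
    · intro m hm
      simp only [Finset.mem_sdiff, mem_range] at hm
      rw [Nat.choose_eq_zero_of_lt (by omega)]
      simp
    · intro m hm
      rw [mem_range] at hm
      rw [← Nat.mul_sub, pow_mul, neg_one_sq, one_pow, one_mul,
        show 2 * q + 1 + 2 * (p - m) - 1 = 2 * (p + q - m) by omega,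
        show 2 * q + 1 + 2 * (p - m) = 2 * (p + q - m) + 1 by omega,
        Nat.choose_symm_of_eq_add (show 2 * (p + q - m) = 2 * (p - m) + 2 * q by omega)]
  have h2 : ∑ m ∈ range ((2 * q + 1) / 2 + 1), mzvStar (List.replicate m 2) *
      ((2 * p + (2 * q + 1 - 2 * m) - 1).choose (2 * q + 1 - 2 * m) *
        ((1 - 2 / 2 ^ (2 * p + (2 * q + 1 - 2 * m))) * mzv [2 * p + (2 * q + 1 - 2 * m)])) =
      ∑ m ∈ range (p + q), mzvStar (List.replicate m 2) *
        ((2 * (p + q - m)).choose (2 * p - 1) *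
          ((1 - 1 / 2 ^ (2 * (p + q - m))) * mzv [2 * (p + q - m) + 1])) := by
    refine sum_subset_zero_on_sdiff (range_subset_range.2 (by omega)) ?_ ?_
    · intro m hm
      simp only [Finset.mem_sdiff, mem_range] at hm
      rw [Nat.choose_eq_zero_of_lt (by omega)]
      simp
    · intro m hm
      rw [mem_range] at hm
      rw [show 2 * p + (2 * q + 1 - 2 * m) - 1 = 2 * (p + q - m) by omega,
        show 2 * p + (2 * q + 1 - 2 * m) = 2 * (p + q - m) + 1 by omega,
        Nat.choose_symm_of_eq_add
          (show 2 * (p + q - m) = (2 * q + 1 - 2 * m) + (2 * p - 1) by omega),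
        pow_succ', div_mul_eq_div_div, div_self two_ne_zero]
  rw [h1, h2, ← sum_sub_distrib]
  refine sum_nbij' (fun m => p + q - m) (fun k => p + q - k) ?_ ?_ ?_ ?_ ?_
  · intro m hm
    simp only [mem_range, mem_Icc] at hm ⊢
    omega
  · intro k hk
    simp only [mem_range, mem_Icc] at hk ⊢
    omega
  · intro m hm
    rw [mem_range] at hm
    omega
  · intro k hk
    rw [mem_Icc] at hk
    omega
  · intro m hm
    rw [mem_range] at hm
    rw [Nat.sub_sub_self hm.le]
    ring
end
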